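/- arXiv:0808.1683 — 10 statements merged into one kernel-verified Lean document; each statement's English description precedes it below -/
import Mathlib

section
/- Every idempotent state φ on a finite quantum group A is invariant under the antipode: φ ∘ S = φ, i.e. φ(S(a)) = φ(a) for all a ∈ A. -/
open TensorProduct HopfAlgebra
open scoped ComplexOrder

noncomputable section

variable {A : Type*} [Ring A] [StarRing A] [HopfAlgebra ℂ A]
  [StarModule ℂ A] [FiniteDimensional ℂ A]

/-- Convolution of linear functionals on a coalgebra: `φ ⋆ ψ := (φ ⊗ ψ) ∘ Δ`. -/
def conv (φ ψ : A →ₗ[ℂ] ℂ) : A →ₗ[ℂ] ℂ :=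
  LinearMap.mul' ℂ ℂ ∘ₗ TensorProduct.map φ ψ ∘ₗ Coalgebra.comul

/-- A state: a unital positive linear functional. -/
def IsState (φ : A →ₗ[ℂ] ℂ) : Prop :=
  φ 1 = 1 ∧ ∀ a : A, 0 ≤ φ (star a * a)

/-- An idempotent state: a state satisfying `φ ⋆ φ = φ`. -/
def IsIdempotentState (φ : A →ₗ[ℂ] ℂ) : Prop :=
  IsState φ ∧ conv φ φ = φ

/-- The Haar state axioms: a faithful state which is a trace and two-sided invariant,
`(h ⊗ id)(Δ a) = h(a)·1 = (id ⊗ h)(Δ a)`. -/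
structure IsHaarState (h : A →ₗ[ℂ] ℂ) : Prop where
  state : IsState h
  faithful : ∀ a : A, h (star a * a) = 0 → a = 0
  left_inv : ∀ a : A,
    TensorProduct.lid ℂ A (TensorProduct.map h LinearMap.id (Coalgebra.comul a)) = h a • 1
  right_inv : ∀ a : A,
    TensorProduct.rid ℂ A (TensorProduct.map LinearMap.id h (Coalgebra.comul a)) = h a • 1
  trace : ∀ a b : A, h (a * b) = h (b * a)

/-- The star-compatibility axioms of a finite quantum group (finite-dimensional Hopf
`*`-algebra): the comultiplication is `*`-preserving (with respect to the entrywise star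
`tstar` on `A ⊗ A`, given as data), and the antipode is `*`-preserving and involutive. -/
structure StarAxioms (tstar : A ⊗[ℂ] A →+ A ⊗[ℂ] A) : Prop where
  tstar_tmul : ∀ a b : A, tstar (a ⊗ₜ[ℂ] b) = star a ⊗ₜ[ℂ] star b
  comul_star : ∀ a : A, Coalgebra.comul (R := ℂ) (star a) = tstar (Coalgebra.comul a)
  antipode_star : ∀ a : A, antipode (R := ℂ) (star a) = star (antipode (R := ℂ) a)
  antipode_invol : ∀ a : A, antipode (R := ℂ) (antipode (R := ℂ) a) = a

/-- A group-like projection: a nonzero self-adjoint idempotent `p` with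
`Δ(p)(1 ⊗ p) = p ⊗ p`. -/
def IsGroupLikeProjection (p : A) : Prop :=
  p ≠ 0 ∧ star p = p ∧ p * p = p ∧
    Coalgebra.comul (R := ℂ) p * ((1 : A) ⊗ₜ[ℂ] p) = p ⊗ₜ[ℂ] p

section TensorFunctional

variable {B : Type*} [Ring B] [Algebra ℂ B]

/-- The tensor product of two linear functionals. -/
def tensorFunctional (f g : B →ₗ[ℂ] ℂ) : B ⊗[ℂ] B →ₗ[ℂ] ℂ :=
  LinearMap.mul' ℂ ℂ ∘ₗ TensorProduct.map f g

@[simp]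
theorem tensorFunctional_tmul (f g : B →ₗ[ℂ] ℂ) (x y : B) :
    tensorFunctional f g (x ⊗ₜ y) = f x * g y := rfl

end TensorFunctional

section PositiveFunctional

variable {B : Type*} [Ring B] [StarRing B] [Algebra ℂ B] [StarModule ℂ B]

/-- A positive functional on a unital `*`-algebra is hermitian. -/
theorem map_star_of_map_star_mul_self_nonneg {f : B →ₗ[ℂ] ℂ} (hf : ∀ x, 0 ≤ f (star x * x))
    (x : B) : f (star x) = star (f x) := by
  have him (y : B) : (f (star y * y)).im = 0 := (Complex.nonneg_iff.mp (hf y)).2.symm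
  have h1 := him (1 + x)
  have h2 := him (1 + Complex.I • x)
  have h3 := him 1
  have h4 := him x
  simp only [star_add, star_one, star_smul, add_mul, mul_add, one_mul, mul_one, smul_mul_assoc,
    mul_smul_comm, map_add, map_smul, smul_eq_mul, Complex.add_im, Complex.mul_im,
    Complex.mul_re, Complex.star_def, Complex.conj_I, Complex.I_re, Complex.I_im,
    Complex.neg_re, Complex.neg_im] at h1 h2 h3 h4
  apply Complex.ext
  · simp only [Complex.star_def, Complex.conj_re]
    linarith
  · simp only [Complex.star_def, Complex.conj_im]
    linarith

/-- The Cauchy–Schwarz inequality for null vectors of a positive functional. -/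
theorem map_star_mul_eq_zero_of_map_star_mul_self_eq_zero {f : B →ₗ[ℂ] ℂ}
    (hf : ∀ x, 0 ≤ f (star x * x)) {x : B} (hx : f (star x * x) = 0) (y : B) :
    f (star y * x) = 0 := by
  let c : PreInnerProductSpace.Core ℂ B :=
    { inner := fun u v => f (star u * v)
      conj_inner_symm := fun u v => by
        simpa using (map_star_of_map_star_mul_self_nonneg hf (star v * u)).symm
      re_inner_nonneg := fun u => (Complex.nonneg_iff.mp (hf u)).1
      add_left := fun u v w => by simp [add_mul]
      smul_left := fun u v r => by simp }
  have hcs : ‖f (star y * x)‖ * ‖f (star x * y)‖ ≤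
      (f (star y * y)).re * (f (star x * x)).re :=
    InnerProductSpace.Core.inner_mul_inner_self_le (𝕜 := ℂ) (F := B) y x
  have hsymm : f (star x * y) = star (f (star y * x)) := by
    simpa using map_star_of_map_star_mul_self_nonneg hf (star y * x)
  rw [hx, hsymm, norm_star, Complex.zero_re, mul_zero] at hcs
  exact norm_eq_zero.mp (mul_self_eq_zero.mp (le_antisymm hcs (mul_self_nonneg _)))

/-- The Gram matrix of a finite family with respect to a positive functional. -/
theorem posSemidef_of_map_star_mul_self_nonneg {ι : Type*} [Fintype ι] {f : B →ₗ[ℂ] ℂ}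
    (hf : ∀ x, 0 ≤ f (star x * x)) (v : ι → B) :
    (Matrix.of fun i j => f (star (v i) * v j)).PosSemidef := by
  refine Matrix.PosSemidef.of_dotProduct_mulVec_nonneg ?_ fun x => ?_
  · ext i j
    simpa using (map_star_of_map_star_mul_self_nonneg hf (star (v j) * v i)).symm
  · convert hf (∑ i, x i • v i) using 1
    simp only [dotProduct, Matrix.mulVec, Matrix.of_apply, Pi.star_apply, star_sum, star_smul,
      Finset.sum_mul, Finset.mul_sum, smul_mul_assoc, mul_smul_comm, map_sum, map_smul, smul_eq_mul]
    rw [Finset.sum_comm]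
    exact Finset.sum_congr rfl fun i _ => Finset.sum_congr rfl fun j _ => by ring

/-- The tensor product of two positive functionals is positive. -/
theorem tensorFunctional_star_mul_self_nonneg {f g : B →ₗ[ℂ] ℂ}
    (hf : ∀ x, 0 ≤ f (star x * x)) (hg : ∀ x, 0 ≤ g (star x * x)) (X : B ⊗[ℂ] B) :
    0 ≤ tensorFunctional f g (star X * X) := by
  obtain ⟨s, rfl⟩ := TensorProduct.exists_finset X
  have hpos := ((posSemidef_of_map_star_mul_self_nonneg hf fun i : s => i.1.1).hadamard
    (posSemidef_of_map_star_mul_self_nonneg hg fun i : s => i.1.2)).dotProduct_mulVec_nonneg 1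
  convert hpos using 1
  rw [← Finset.sum_coe_sort s]
  simp [dotProduct, Matrix.mulVec, star_sum, Finset.sum_mul, Finset.mul_sum]
  exact Finset.sum_comm

end PositiveFunctional

section Slice

variable {B : Type*} [Ring B] [Algebra ℂ B]

/-- The left slice map `f ⊗ id`. -/
def leftSlice (f : B →ₗ[ℂ] ℂ) : B ⊗[ℂ] B →ₗ[ℂ] B :=
  (TensorProduct.lid ℂ B).toLinearMap ∘ₗ TensorProduct.map f LinearMap.id

/-- The right slice map `id ⊗ f`. -/
def rightSlice (f : B →ₗ[ℂ] ℂ) : B ⊗[ℂ] B →ₗ[ℂ] B :=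
  (TensorProduct.rid ℂ B).toLinearMap ∘ₗ TensorProduct.map LinearMap.id f

@[simp]
theorem leftSlice_tmul (f : B →ₗ[ℂ] ℂ) (x y : B) : leftSlice f (x ⊗ₜ y) = f x • y := by
  simp [leftSlice]

@[simp]
theorem rightSlice_tmul (f : B →ₗ[ℂ] ℂ) (x y : B) : rightSlice f (x ⊗ₜ y) = f y • x := by
  simp [rightSlice]

theorem map_rightSlice (f g : B →ₗ[ℂ] ℂ) (Z : B ⊗[ℂ] B) :
    f (rightSlice g Z) = tensorFunctional f g Z := by
  induction Z with
  | zero => simp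
  | tmul x y => simp [mul_comm]
  | add Z W hZ hW => simp [hZ, hW]

theorem map_leftSlice_mul (f g : B →ₗ[ℂ] ℂ) (Z : B ⊗[ℂ] B) (d : B) :
    g (leftSlice f Z * d) = tensorFunctional f g (Z * 1 ⊗ₜ d) := by
  induction Z with
  | zero => simp
  | tmul x y => simp
  | add Z W hZ hW => simp [add_mul, hZ, hW]

theorem map_mul_leftSlice (f g : B →ₗ[ℂ] ℂ) (Z : B ⊗[ℂ] B) (d : B) :
    g (d * leftSlice f Z) = tensorFunctional f g (1 ⊗ₜ d * Z) := by
  induction Z with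
  | zero => simp
  | tmul x y => simp
  | add Z W hZ hW => simp [mul_add, hZ, hW]

theorem rightSlice_tmul_mul (g : B →ₗ[ℂ] ℂ) (x y : B) (Z : B ⊗[ℂ] B) :
    rightSlice g (x ⊗ₜ y * Z) = x * rightSlice g (1 ⊗ₜ y * Z) := by
  induction Z with
  | zero => simp
  | tmul u v => simp
  | add Z W hZ hW => simp [mul_add, hZ, hW]

theorem leftSlice_star [StarRing B] [StarModule ℂ B] {f : B →ₗ[ℂ] ℂ}
    (hf : ∀ x, 0 ≤ f (star x * x)) (Z : B ⊗[ℂ] B) :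
    leftSlice f (star Z) = star (leftSlice f Z) := by
  induction Z with
  | zero => simp
  | tmul x y => simp [map_star_of_map_star_mul_self_nonneg hf]
  | add Z W hZ hW => simp [hZ, hW]

end Slice

section Hopf

variable {B : Type*} [Ring B] [HopfAlgebra ℂ B]

theorem counit_leftSlice_comul (f : B →ₗ[ℂ] ℂ) (a : B) :
    Coalgebra.counit (R := ℂ) (leftSlice f (Coalgebra.comul a)) = f a := by
  have key (Z : B ⊗[ℂ] B) : Coalgebra.counit (R := ℂ) (leftSlice f Z) =
      f (TensorProduct.rid ℂ B (Coalgebra.counit.lTensor B Z)) := by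
    induction Z with
    | zero => simp
    | tmul x y => simp [mul_comm]
    | add Z W hZ hW => simp [hZ, hW]
  simp [key]

theorem leftSlice_comul_leftSlice_comul (f g : B →ₗ[ℂ] ℂ) (a : B) :
    leftSlice g (Coalgebra.comul (leftSlice f (Coalgebra.comul a))) =
      leftSlice (conv f g) (Coalgebra.comul a) := by
  let K : B ⊗[ℂ] (B ⊗[ℂ] B) →ₗ[ℂ] B :=
    (TensorProduct.lid ℂ B).toLinearMap ∘ₗ TensorProduct.map f (leftSlice g)
  have hl (Z : B ⊗[ℂ] B) :
      K (Coalgebra.comul.lTensor B Z) = leftSlice g (Coalgebra.comul (leftSlice f Z)) := by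
    induction Z with
    | zero => simp
    | tmul x y => simp [K]
    | add Z W hZ hW => simp only [map_add, hZ, hW]
  have hassoc (W : B ⊗[ℂ] B) (y : B) :
      K (TensorProduct.assoc ℂ B B B (W ⊗ₜ y)) = tensorFunctional f g W • y := by
    induction W with
    | zero => simp
    | tmul u v => simp [K, mul_smul, smul_comm (g v)]
    | add Z W hZ hW => simp only [TensorProduct.add_tmul, map_add, hZ, hW, add_smul]
  have hr (Z : B ⊗[ℂ] B) :
      K (TensorProduct.assoc ℂ B B B (Coalgebra.comul.rTensor B Z)) =
        leftSlice (conv f g) Z := by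
    induction Z with
    | zero => simp
    | tmul x y => rw [LinearMap.rTensor_tmul, hassoc, leftSlice_tmul]; rfl
    | add Z W hZ hW => simp only [map_add, hZ, hW]
  rw [← hl, ← hr, Coalgebra.coassoc_apply]

/-- Strong invariance of a right invariant functional `g`:
`(id ⊗ g)((1 ⊗ b) Δ(a)) = (S ⊗ g)(Δ(b) (1 ⊗ a))`. -/
theorem rightSlice_strong_invariance {g : B →ₗ[ℂ] ℂ}
    (hg : ∀ a, rightSlice g (Coalgebra.comul a) = g a • 1) (a b : B) :
    rightSlice g (1 ⊗ₜ b * Coalgebra.comul a) =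
      antipode ℂ (rightSlice g (Coalgebra.comul b * 1 ⊗ₜ a)) := by
  let r : B →ₗ[ℂ] B := rightSlice g ∘ₗ LinearMap.mulRight ℂ (Coalgebra.comul a) ∘ₗ
    TensorProduct.mk ℂ B B 1
  have hr (z : B) : r z = rightSlice g (1 ⊗ₜ z * Coalgebra.comul a) := rfl
  let M : B ⊗[ℂ] (B ⊗[ℂ] B) →ₗ[ℂ] B :=
    LinearMap.mul' ℂ B ∘ₗ TensorProduct.map
      (LinearMap.mul' ℂ B ∘ₗ (antipode ℂ).rTensor B) r ∘ₗ
      (TensorProduct.assoc ℂ B B B).symm.toLinearMap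
  have hM (x : B) (W : B ⊗[ℂ] B) :
      M (x ⊗ₜ W) = antipode ℂ x * rightSlice g (W * Coalgebra.comul a) := by
    induction W with
    | zero => simp
    | tmul u v => rw [rightSlice_tmul_mul]; simp [M, hr, mul_assoc]
    | add Z W hZ hW => simp only [TensorProduct.tmul_add, map_add, hZ, hW, add_mul, mul_add]
  have hl (Z : B ⊗[ℂ] B) :
      M (Coalgebra.comul.lTensor B Z) = antipode ℂ (rightSlice g (Z * 1 ⊗ₜ a)) := by
    induction Z with
    | zero => simp
    | tmul x y => rw [LinearMap.lTensor_tmul, hM, ← Bialgebra.comul_mul, hg]; simp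
    | add Z W hZ hW => simp only [map_add, hZ, hW, add_mul]
  have hrr (Z : B ⊗[ℂ] B) :
      M (TensorProduct.assoc ℂ B B B (Coalgebra.comul.rTensor B Z)) =
        r (TensorProduct.lid ℂ B (Coalgebra.counit.rTensor B Z)) := by
    induction Z with
    | zero => simp
    | tmul x y => simp [M, ← Algebra.smul_def]
    | add Z W hZ hW => simp only [map_add, hZ, hW]
  rw [← hl, ← Coalgebra.coassoc_apply, hrr, Coalgebra.rTensor_counit_comul, TensorProduct.lid_tmul,
    one_smul, hr]

/-- The adjoint of left convolution by `f` with respect to an invariant functional is left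
convolution by `f ∘ S`. -/
theorem map_mul_leftSlice_comul {f g : B →ₗ[ℂ] ℂ}
    (hg : ∀ a, rightSlice g (Coalgebra.comul a) = g a • 1) (a b : B) :
    g (b * leftSlice f (Coalgebra.comul a)) =
      g (leftSlice (f ∘ₗ antipode ℂ) (Coalgebra.comul b) * a) := by
  rw [map_mul_leftSlice, map_leftSlice_mul, ← map_rightSlice, ← map_rightSlice,
    rightSlice_strong_invariance hg, LinearMap.comp_apply]

end Hopf

section IdempotentState

variable {B : Type*} [Ring B] [StarRing B] [HopfAlgebra ℂ B] [StarModule ℂ B]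

/-- Left convolution by an idempotent state is symmetric with respect to an invariant positive
functional. -/
theorem map_leftSlice_comul_mul_comm {f g : B →ₗ[ℂ] ℂ}
    (hcomul : ∀ a : B, Coalgebra.comul (R := ℂ) (star a) = star (Coalgebra.comul (R := ℂ) a))
    (hg : ∀ a, rightSlice g (Coalgebra.comul a) = g a • 1) (hgpos : ∀ x, 0 ≤ g (star x * x))
    (hf_one : f 1 = 1) (hfpos : ∀ x, 0 ≤ f (star x * x)) (hf : conv f f = f) (a b : B) :
    g (leftSlice f (Coalgebra.comul a) * b) = g (a * leftSlice f (Coalgebra.comul b)) := by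
  set T : B → B := fun x => leftSlice f (Coalgebra.comul x) with hT
  have hstar (x : B) : T (star x) = star (T x) := by
    simp only [hT, hcomul, leftSlice_star hfpos]
  have hTT (x : B) : T (T x) = T x := by
    simp only [hT, leftSlice_comul_leftSlice_comul, hf]
  have hcomul_apply (x : B) : tensorFunctional f g (Coalgebra.comul x) = g x := by
    rw [← map_rightSlice, hg, map_smul, hf_one, smul_eq_mul, mul_one]
  have hΦ := tensorFunctional_star_mul_self_nonneg hfpos hgpos
  have hrange (x y : B) : g (y * T x) = g (T y * T x) := by
    have hnull : tensorFunctional f g (star (Coalgebra.comul (T x) - 1 ⊗ₜ T x) *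
        (Coalgebra.comul (T x) - 1 ⊗ₜ T x)) = 0 := by
      have h1 := map_leftSlice_mul f g (Coalgebra.comul (star (T x))) (T x)
      have h2 := map_mul_leftSlice f g (Coalgebra.comul (T x)) (star (T x))
      change g (T (star (T x)) * T x) = _ at h1
      change g (star (T x) * T (T x)) = _ at h2
      rw [hstar, hTT] at h1
      rw [hTT] at h2
      rw [star_sub, ← hcomul, star_tmul, star_one, sub_mul, mul_sub, mul_sub, map_sub, map_sub,
        map_sub, ← Bialgebra.comul_mul, hcomul_apply, ← h1, ← h2,
        Algebra.TensorProduct.tmul_mul_tmul, one_mul, tensorFunctional_tmul, hf_one, one_mul,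
        sub_self]
    have h3 := map_star_mul_eq_zero_of_map_star_mul_self_eq_zero hΦ hnull
      (Coalgebra.comul (star y))
    rw [← hcomul, star_star, mul_sub, map_sub, ← Bialgebra.comul_mul, hcomul_apply,
      ← map_leftSlice_mul] at h3
    exact sub_eq_zero.mp h3
  have hrange' (x y : B) : g (T x * y) = g (T x * T y) := by
    have h4 := congrArg star (hrange (star x) (star y))
    rw [← map_star_of_map_star_mul_self_nonneg hgpos,
      ← map_star_of_map_star_mul_self_nonneg hgpos] at h4
    simpa [hstar] using h4
  exact (hrange' a b).trans (hrange b a).symm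

end IdempotentState

/-- Every idempotent state on a finite quantum group is invariant under the antipode. -/
theorem idempotent_state_antipode_invariant
    (h : A →ₗ[ℂ] ℂ) (hh : IsHaarState h)
    (tstar : A ⊗[ℂ] A →+ A ⊗[ℂ] A) (hstar : StarAxioms tstar)
    (φ : A →ₗ[ℂ] ℂ) (hφ : IsIdempotentState φ) :
    ∀ a : A, φ (antipode (R := ℂ) a) = φ a := by
  have htstar (Z : A ⊗[ℂ] A) : tstar Z = star Z := by
    induction Z with
    | zero => simp
    | tmul x y => rw [hstar.tstar_tmul, star_tmul]
    | add Z W hZ hW => rw [map_add, hZ, hW, star_add]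
  have hcomul (a : A) :
      Coalgebra.comul (R := ℂ) (star a) = star (Coalgebra.comul (R := ℂ) a) := by
    rw [hstar.comul_star, htstar]
  obtain ⟨⟨hφ_one, hφ_pos⟩, hφ_conv⟩ := hφ
  intro a
  have hslice : leftSlice (φ ∘ₗ antipode ℂ) (Coalgebra.comul a) =
      leftSlice φ (Coalgebra.comul a) := by
    refine sub_eq_zero.mp (hh.faithful _ ?_)
    rw [hh.trace, sub_mul, map_sub, ← map_mul_leftSlice_comul hh.right_inv,
      map_leftSlice_comul_mul_comm hcomul hh.right_inv hh.state.2 hφ_one hφ_pos hφ_conv, sub_self]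
  rw [← counit_leftSlice_comul φ a, ← hslice, counit_leftSlice_comul, LinearMap.comp_apply]
end
end

section
/- Let φ be an idempotent state on a finite quantum group A. Then, regarded as an element of the dual convolution algebra, φ is a group-like projection: φ(a*) equals the complex conjugate of φ(a) for every a ∈ A, and for all a, b ∈ A one has (φ ⊗ φ)((a ⊗ 1)·Δ(b)) = φ(a)·φ(b) and (φ ⊗ φ)((1 ⊗ a)·Δ(b)) = φ(a)·φ(b). -/
open TensorProduct HopfAlgebra
open scoped ComplexOrder

noncomputable section

variable {A : Type*} [Ring A] [StarRing A] [HopfAlgebra ℂ A]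
  [StarModule ℂ A] [FiniteDimensional ℂ A]

/-- The slice map `a ↦ (id ⊗ f)(D a)` attached to a linear functional `f`. -/
def sliceMap (D : A →ₗ[ℂ] A ⊗[ℂ] A) (f : A →ₗ[ℂ] ℂ) : A →ₗ[ℂ] A :=
  (TensorProduct.rid ℂ A).toLinearMap ∘ₗ TensorProduct.map LinearMap.id f ∘ₗ D

omit [FiniteDimensional ℂ A] in
theorem IsState.star_mul_conj {φ : A →ₗ[ℂ] ℂ} (hφ : IsState φ) (a b : A) :
    φ (star a * b) = starRingEnd ℂ (φ (star b * a)) := by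
  have ha := (Complex.nonneg_iff.1 (hφ.2 a)).2
  have hb := (Complex.nonneg_iff.1 (hφ.2 b)).2
  have h1 := (Complex.nonneg_iff.1 (hφ.2 (a + b))).2
  have h2 := (Complex.nonneg_iff.1 (hφ.2 (a + Complex.I • b))).2
  simp only [star_add, star_smul, add_mul, mul_add, smul_mul_assoc, mul_smul_comm, map_add,
    map_smul, smul_eq_mul, Complex.add_im, Complex.mul_im, Complex.mul_re, Complex.star_def,
    Complex.conj_I, Complex.neg_re, Complex.neg_im, Complex.I_re, Complex.I_im] at h1 h2
  apply Complex.ext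
  · rw [Complex.conj_re]; linarith
  · rw [Complex.conj_im]; linarith

omit [FiniteDimensional ℂ A] in
theorem IsState.map_star {φ : A →ₗ[ℂ] ℂ} (hφ : IsState φ) (a : A) :
    φ (star a) = starRingEnd ℂ (φ a) := by
  simpa using hφ.star_mul_conj a 1

/-- The semi-inner product `⟪a, b⟫ = φ (a* b)` of a state. -/
abbrev IsState.preInnerCore {φ : A →ₗ[ℂ] ℂ} (hφ : IsState φ) : PreInnerProductSpace.Core ℂ A where
  inner a b := φ (star a * b)
  conj_inner_symm a b := (hφ.star_mul_conj a b).symm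
  re_inner_nonneg a := (Complex.nonneg_iff.1 (hφ.2 a)).1
  add_left a b c := by simp [add_mul]
  smul_left a b r := by simp

/-- The inner product `⟪a, b⟫ = h (a* b)` of a faithful state. -/
abbrev IsHaarState.innerCore {h : A →ₗ[ℂ] ℂ} (hh : IsHaarState h) :
    InnerProductSpace.Core ℂ A where
  __ := hh.state.preInnerCore
  definite a ha := hh.faithful a ha

omit [FiniteDimensional ℂ A] in
theorem IsState.mul_eq_zero {φ : A →ₗ[ℂ] ℂ} (hφ : IsState φ) {v : A} (hv : φ (star v * v) = 0)
    (a : A) : φ (a * v) = 0 := by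
  let := hφ.preInnerCore
  have key := InnerProductSpace.Core.inner_mul_inner_self_le (𝕜 := ℂ) (F := A) (star a) v
  change ‖φ (star (star a) * v)‖ * ‖φ (star v * star a)‖ ≤
    RCLike.re (φ (star (star a) * star a)) * RCLike.re (φ (star v * v)) at key
  rw [hv, hφ.star_mul_conj v (star a), star_star, RCLike.norm_conj, map_zero, mul_zero] at key
  exact norm_eq_zero.1 (mul_self_eq_zero.1 (le_antisymm key (mul_self_nonneg _)))

theorem IsHaarState.exists_orthonormal_basis {h : A →ₗ[ℂ] ℂ} (hh : IsHaarState h) :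
    ∃ (n : ℕ) (e : Module.Basis (Fin n) ℂ A),
      ∀ i j, h (star (e i) * e j) = if i = j then 1 else 0 := by
  let : NormedAddCommGroup A := @InnerProductSpace.Core.toNormedAddCommGroup ℂ A _ _ _ hh.innerCore
  let : InnerProductSpace ℂ A := InnerProductSpace.ofCore hh.innerCore.toCore
  let b := stdOrthonormalBasis ℂ A
  refine ⟨_, b.toBasis, fun i j => ?_⟩
  have := orthonormal_iff_ite.1 b.orthonormal i j
  rw [b.coe_toBasis]
  exact this

/-- The left kernel of `h ⊗ φ` for `h` faithful: an element `y` with `(h ⊗ φ)(y* y) = 0` satisfies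
`(id ⊗ φ)((1 ⊗ a) y) = 0` for all `a`. -/
theorem slice_eq_zero {h : A →ₗ[ℂ] ℂ} (hh : IsHaarState h)
    {tstar : A ⊗[ℂ] A →+ A ⊗[ℂ] A} (hstar : StarAxioms tstar)
    {φ : A →ₗ[ℂ] ℂ} (hφ : IsState φ) {y : A ⊗[ℂ] A}
    (hy : LinearMap.mul' ℂ ℂ (TensorProduct.map h φ (tstar y * y)) = 0) (a : A) :
    TensorProduct.map LinearMap.id (φ ∘ₗ LinearMap.mulLeft ℂ a) y = 0 := by
  obtain ⟨n, e, he⟩ := hh.exists_orthonormal_basis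
  obtain ⟨c, rfl⟩ := TensorProduct.eq_repr_basis_left e y
  rw [Finsupp.sum_fintype _ _ (by simp)] at hy ⊢
  have hsum : ∑ i, φ (star (c i) * c i) = 0 := by
    simpa [map_sum, hstar.tstar_tmul, Finset.sum_mul_sum, he] using hy
  have hc : ∀ i, φ (star (c i) * c i) = 0 := fun i =>
    (Finset.sum_eq_zero_iff_of_nonneg fun i _ => hφ.2 (c i)).1 hsum i (Finset.mem_univ i)
  simp [map_sum, hφ.mul_eq_zero (hc _)]

/-- For a `*`-homomorphism `D : A → A ⊗ A` leaving `h` invariant, fixed points of the slice map of a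
state `φ` satisfy `(id ⊗ φ)((1 ⊗ a) D x) = φ(a) x`. -/
theorem sliceMap_mulLeft_of_fixed {h : A →ₗ[ℂ] ℂ} (hh : IsHaarState h)
    {tstar : A ⊗[ℂ] A →+ A ⊗[ℂ] A} (hstar : StarAxioms tstar)
    {φ : A →ₗ[ℂ] ℂ} (hφ : IsState φ) {D : A →ₗ[ℂ] A ⊗[ℂ] A}
    (Dmul : ∀ a b, D (a * b) = D a * D b) (Dstar : ∀ a, D (star a) = tstar (D a))
    (Dinv : ∀ a, TensorProduct.lid ℂ A (TensorProduct.map h LinearMap.id (D a)) = h a • 1)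
    {x : A} (hx : sliceMap D φ x = x) (a : A) :
    sliceMap D (φ ∘ₗ LinearMap.mulLeft ℂ a) x = φ a • x := by
  have inv (w : A) : LinearMap.mul' ℂ ℂ (TensorProduct.map h φ (D w)) = h w := by
    have aux (z : A ⊗[ℂ] A) : LinearMap.mul' ℂ ℂ (TensorProduct.map h φ z) =
        φ (TensorProduct.lid ℂ A (TensorProduct.map h LinearMap.id z)) := by
      induction z with
      | zero => simp
      | tmul p q => simp
      | add p q hp hq => simp only [map_add, hp, hq]
    rw [aux, Dinv, map_smul, hφ.1, smul_eq_mul, mul_one]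
  have left (u : A) (z : A ⊗[ℂ] A) :
      LinearMap.mul' ℂ ℂ (TensorProduct.map h φ ((u ⊗ₜ[ℂ] (1 : A)) * z)) =
        h (u * TensorProduct.rid ℂ A (TensorProduct.map LinearMap.id φ z)) := by
    induction z with
    | zero => simp
    | tmul p q => simp [mul_comm]
    | add p q hp hq => simp only [mul_add, map_add, hp, hq]
  have right (u : A) (z : A ⊗[ℂ] A) :
      LinearMap.mul' ℂ ℂ (TensorProduct.map h φ (z * (u ⊗ₜ[ℂ] (1 : A)))) =
        h (TensorProduct.rid ℂ A (TensorProduct.map LinearMap.id φ z) * u) := by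
    induction z with
    | zero => simp
    | tmul p q => simp [mul_comm]
    | add p q hp hq => simp only [add_mul, map_add, hp, hq]
  have hconj (z : A ⊗[ℂ] A) :
      TensorProduct.rid ℂ A (TensorProduct.map LinearMap.id φ (tstar z)) =
        star (TensorProduct.rid ℂ A (TensorProduct.map LinearMap.id φ z)) := by
    induction z with
    | zero => simp
    | tmul p q => simp [hstar.tstar_tmul, hφ.map_star]
    | add p q hp hq => simp only [map_add, star_add, hp, hq]
  have hx' : TensorProduct.rid ℂ A (TensorProduct.map LinearMap.id φ (D x)) = x := hx
  have null : LinearMap.mul' ℂ ℂ (TensorProduct.map h φ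
      (tstar (D x - x ⊗ₜ[ℂ] 1) * (D x - x ⊗ₜ[ℂ] 1))) = 0 := by
    rw [map_sub, hstar.tstar_tmul, star_one, sub_mul, mul_sub, mul_sub, ← Dstar, ← Dmul]
    simp only [map_sub]
    rw [inv, right, left, left, Dstar, hconj, hx']
    simp [hφ.1]
  have zero := slice_eq_zero hh hstar hφ null a
  rw [map_sub, sub_eq_zero] at zero
  simp [sliceMap, zero]

omit [StarRing A] [StarModule ℂ A] [FiniteDimensional ℂ A] in
theorem sliceMap_comul_sliceMap (f g : A →ₗ[ℂ] ℂ) (b : A) :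
    sliceMap Coalgebra.comul f (sliceMap Coalgebra.comul g b) =
      sliceMap Coalgebra.comul (conv f g) b := by
  have aux (z : A ⊗[ℂ] A) :
      sliceMap Coalgebra.comul f (TensorProduct.rid ℂ A (TensorProduct.map LinearMap.id g z)) =
        TensorProduct.rid ℂ A (TensorProduct.map LinearMap.id
          (LinearMap.mul' ℂ ℂ ∘ₗ TensorProduct.map f g)
          (TensorProduct.assoc ℂ A A A (Coalgebra.comul.rTensor A z))) := by
    induction z with
    | zero => simp
    | add p q hp hq => simp only [map_add, hp, hq]
    | tmul p q =>
      simp only [TensorProduct.map_tmul, TensorProduct.rid_tmul, map_smul, sliceMap,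
        LinearMap.comp_apply, LinearMap.rTensor_tmul, LinearMap.id_apply]
      induction Coalgebra.comul (R := ℂ) p with
      | zero => simp
      | add p q hp hq => simp only [map_add, smul_add, hp, hq, TensorProduct.add_tmul]
      | tmul p r => simp [smul_smul, mul_comm]
  have h := aux (Coalgebra.comul b)
  rw [Coalgebra.coassoc_apply] at h
  refine h.trans ?_
  simp only [sliceMap, LinearMap.comp_apply, conv]
  induction Coalgebra.comul (R := ℂ) b with
  | zero => simp
  | add p q hp hq => simp only [map_add, hp, hq]
  | tmul p r => simp

omit [StarRing A] [StarModule ℂ A] [FiniteDimensional ℂ A] in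
theorem counit_sliceMap_comul (f : A →ₗ[ℂ] ℂ) (b : A) :
    Coalgebra.counit (R := ℂ) (sliceMap Coalgebra.comul f b) = f b := by
  have aux (z : A ⊗[ℂ] A) :
      Coalgebra.counit (R := ℂ) (TensorProduct.rid ℂ A (TensorProduct.map LinearMap.id f z)) =
        f (TensorProduct.lid ℂ A (Coalgebra.counit.rTensor A z)) := by
    induction z with
    | zero => simp
    | add p q hp hq => simp only [map_add, hp, hq]
    | tmul p q => simp [mul_comm]
  have h := aux (Coalgebra.comul b)
  rw [Coalgebra.rTensor_counit_comul] at h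
  simpa [sliceMap] using h

/-- The opposite comultiplication. -/
def comulOp : A →ₗ[ℂ] A ⊗[ℂ] A :=
  (TensorProduct.comm ℂ A A).toLinearMap ∘ₗ Coalgebra.comul

omit [StarRing A] [StarModule ℂ A] [FiniteDimensional ℂ A] in
theorem sliceMap_comulOp_sliceMap (f g : A →ₗ[ℂ] ℂ) (b : A) :
    sliceMap comulOp f (sliceMap comulOp g b) = sliceMap comulOp (conv g f) b := by
  have aux (z : A ⊗[ℂ] A) :
      sliceMap comulOp f (TensorProduct.rid ℂ A (TensorProduct.map LinearMap.id g
        (TensorProduct.comm ℂ A A z))) =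
        TensorProduct.lid ℂ A (TensorProduct.map
          (LinearMap.mul' ℂ ℂ ∘ₗ TensorProduct.map g f) LinearMap.id
          ((TensorProduct.assoc ℂ A A A).symm (Coalgebra.comul.lTensor A z))) := by
    induction z with
    | zero => simp
    | add p q hp hq => simp only [map_add, hp, hq]
    | tmul p q =>
      simp only [TensorProduct.map_tmul, TensorProduct.rid_tmul, map_smul, sliceMap, comulOp,
        LinearMap.comp_apply, LinearMap.lTensor_tmul, LinearMap.id_apply, TensorProduct.comm_tmul]
      induction Coalgebra.comul (R := ℂ) q with
      | zero => simp
      | add p q hp hq => simp only [map_add, smul_add, hp, hq, TensorProduct.tmul_add]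
      | tmul p r => simp [smul_smul]
  have h := aux (Coalgebra.comul b)
  rw [Coalgebra.coassoc_symm_apply] at h
  refine h.trans ?_
  simp only [sliceMap, comulOp, LinearMap.comp_apply, conv]
  induction Coalgebra.comul (R := ℂ) b with
  | zero => simp
  | add p q hp hq => simp only [map_add, hp, hq]
  | tmul p r => simp

omit [StarRing A] [StarModule ℂ A] [FiniteDimensional ℂ A] in
theorem counit_sliceMap_comulOp (f : A →ₗ[ℂ] ℂ) (b : A) :
    Coalgebra.counit (R := ℂ) (sliceMap comulOp f b) = f b := by
  have aux (z : A ⊗[ℂ] A) :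
      Coalgebra.counit (R := ℂ) (TensorProduct.rid ℂ A (TensorProduct.map LinearMap.id f
        (TensorProduct.comm ℂ A A z))) =
        f (TensorProduct.rid ℂ A (Coalgebra.counit.lTensor A z)) := by
    induction z with
    | zero => simp
    | add p q hp hq => simp only [map_add, hp, hq]
    | tmul p q => simp [mul_comm]
  have h := aux (Coalgebra.comul b)
  rw [Coalgebra.lTensor_counit_comul] at h
  simpa [sliceMap, comulOp] using h

omit [StarRing A] [StarModule ℂ A] [FiniteDimensional ℂ A] in
theorem comulOp_mul (a b : A) : (comulOp (a * b) : A ⊗[ℂ] A) = comulOp a * comulOp b := by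
  have aux (y z : A ⊗[ℂ] A) : TensorProduct.comm ℂ A A (y * z) =
      TensorProduct.comm ℂ A A y * TensorProduct.comm ℂ A A z :=
    map_mul (Algebra.TensorProduct.comm ℂ A A) y z
  simp only [comulOp, LinearMap.comp_apply, Bialgebra.comul_mul]
  exact aux _ _

omit [StarModule ℂ A] [FiniteDimensional ℂ A] in
theorem comulOp_star {tstar : A ⊗[ℂ] A →+ A ⊗[ℂ] A} (hstar : StarAxioms tstar) (a : A) :
    comulOp (star a) = tstar (comulOp a) := by
  simp only [comulOp, LinearMap.comp_apply, hstar.comul_star, LinearEquiv.coe_coe]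
  induction Coalgebra.comul (R := ℂ) a with
  | zero => simp
  | add p q hp hq => simp only [map_add, hp, hq]
  | tmul p q => simp [hstar.tstar_tmul]

omit [StarModule ℂ A] [FiniteDimensional ℂ A] in
theorem IsHaarState.comulOp_inv {h : A →ₗ[ℂ] ℂ} (hh : IsHaarState h) (a : A) :
    TensorProduct.lid ℂ A (TensorProduct.map h LinearMap.id (comulOp a)) = h a • 1 := by
  rw [← hh.right_inv, comulOp, LinearMap.comp_apply]
  induction Coalgebra.comul (R := ℂ) a with
  | zero => simp
  | add p q hp hq => simp only [map_add, hp, hq]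
  | tmul p q => simp

theorem IsIdempotentState.conv_mulLeft_left {h : A →ₗ[ℂ] ℂ} (hh : IsHaarState h)
    {tstar : A ⊗[ℂ] A →+ A ⊗[ℂ] A} (hstar : StarAxioms tstar)
    {φ : A →ₗ[ℂ] ℂ} (hφ : IsIdempotentState φ) (a b : A) :
    conv (φ ∘ₗ LinearMap.mulLeft ℂ a) φ b = φ a * φ b := by
  have hx : sliceMap Coalgebra.comul φ (sliceMap Coalgebra.comul φ b) =
      sliceMap Coalgebra.comul φ b := by
    rw [sliceMap_comul_sliceMap, hφ.2]
  have key := sliceMap_mulLeft_of_fixed hh hstar hφ.1 Bialgebra.comul_mul hstar.comul_star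
    hh.left_inv hx a
  rw [sliceMap_comul_sliceMap] at key
  simpa [counit_sliceMap_comul] using congrArg (Coalgebra.counit (R := ℂ)) key

theorem IsIdempotentState.conv_mulLeft_right {h : A →ₗ[ℂ] ℂ} (hh : IsHaarState h)
    {tstar : A ⊗[ℂ] A →+ A ⊗[ℂ] A} (hstar : StarAxioms tstar)
    {φ : A →ₗ[ℂ] ℂ} (hφ : IsIdempotentState φ) (a b : A) :
    conv φ (φ ∘ₗ LinearMap.mulLeft ℂ a) b = φ a * φ b := by
  have hx : sliceMap comulOp φ (sliceMap comulOp φ b) = sliceMap comulOp φ b := by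
    rw [sliceMap_comulOp_sliceMap, hφ.2]
  have key := sliceMap_mulLeft_of_fixed hh hstar hφ.1 comulOp_mul (comulOp_star hstar)
    hh.comulOp_inv hx a
  rw [sliceMap_comulOp_sliceMap] at key
  simpa [counit_sliceMap_comulOp] using congrArg (Coalgebra.counit (R := ℂ)) key

/-- An idempotent state on a finite quantum group, viewed in the dual convolution algebra,
is a group-like projection: it is self-adjoint, and satisfies
`(φ ⊗ φ)((a ⊗ 1)·Δ(b)) = φ(a)·φ(b)` and `(φ ⊗ φ)((1 ⊗ a)·Δ(b)) = φ(a)·φ(b)`. -/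
theorem idempotent_state_is_group_like_projection_in_dual
    (h : A →ₗ[ℂ] ℂ) (hh : IsHaarState h)
    (tstar : A ⊗[ℂ] A →+ A ⊗[ℂ] A) (hstar : StarAxioms tstar)
    (φ : A →ₗ[ℂ] ℂ) (hφ : IsIdempotentState φ) :
    (∀ a : A, φ (star a) = starRingEnd ℂ (φ a)) ∧
    (∀ a b : A,
      LinearMap.mul' ℂ ℂ (TensorProduct.map φ φ
        ((a ⊗ₜ[ℂ] (1 : A)) * Coalgebra.comul (R := ℂ) b)) = φ a * φ b) ∧
    (∀ a b : A,
      LinearMap.mul' ℂ ℂ (TensorProduct.map φ φ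
        (((1 : A) ⊗ₜ[ℂ] a) * Coalgebra.comul (R := ℂ) b)) = φ a * φ b) := by
  refine ⟨hφ.1.map_star, fun a b => ?_, fun a b => ?_⟩
  · rw [← hφ.conv_mulLeft_left hh hstar a b]
    simp only [conv, LinearMap.comp_apply]
    induction Coalgebra.comul (R := ℂ) b with
    | zero => simp
    | add p q hp hq => simp only [mul_add, map_add, hp, hq]
    | tmul p q => simp
  · rw [← hφ.conv_mulLeft_right hh hstar a b]
    simp only [conv, LinearMap.comp_apply]
    induction Coalgebra.comul (R := ℂ) b with
    | zero => simp
    | add p q hp hq => simp only [mul_add, map_add, hp, hq]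
    | tmul p q => simp
end
end

section
/- Let A be a finite quantum group with Haar state h (a faithful trace) and Haar element η, and assume S² = id. For all a, b, x ∈ A, the linear functional on A ⊗ A determined by u ⊗ v ↦ h(u·b)·h(S(v)·x·a), applied to Δ(η), equals h(η)·h(x·a·b). Equivalently, writing Δ(η) = Σ η₍₁₎ ⊗ η₍₂₎ in Sweedler notation: Σ h(η₍₁₎ b)·h(S(η₍₂₎)·x·a) = h(η)·h(x a b); this says the inverse Fourier transform sends the product φ₁ ⊛ φ₂ := x ↦ (1/h(η))·Σ φ₁(S⁻¹(η₍₂₎)x)·φ₂(η₍₁₎) of φ₁ = h(·a), φ₂ = h(·b) to the product ab in A. -/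
open TensorProduct HopfAlgebra
open scoped ComplexOrder

noncomputable section

variable {A : Type*} [Ring A] [StarRing A] [HopfAlgebra ℂ A]
  [StarModule ℂ A] [FiniteDimensional ℂ A]

/-- `Σ Δ(b₍₁₎) (1 ⊗ S(b₍₂₎)) = b ⊗ 1`. -/
theorem sum_comul_mul_one_tmul_antipode {R H : Type*} [CommSemiring R] [Semiring H]
    [HopfAlgebra R H] {ι : Type*} {b : H} (r : Coalgebra.Repr R b ι) :
    ∑ i ∈ r.index, Coalgebra.comul (R := R) (r.left i) *
      ((1 : H) ⊗ₜ[R] antipode R (r.right i)) = b ⊗ₜ[R] (1 : H) := by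
  let F : H ⊗[R] (H ⊗[R] H) →ₗ[R] H ⊗[R] H :=
    TensorProduct.map LinearMap.id (LinearMap.mul' R H ∘ₗ (antipode R).lTensor H)
  have hF (u : H ⊗[R] H) (v : H) :
      u * ((1 : H) ⊗ₜ[R] antipode R v) = F (TensorProduct.assoc R H H H (u ⊗ₜ[R] v)) := by
    induction u with
    | zero => simp
    | add x y hx hy => simp only [add_mul, hx, hy, TensorProduct.add_tmul, map_add]
    | tmul x y => simp [F]
  have hcoassoc := congrArg F (Coalgebra.coassoc_apply (R := R) b)
  have hcounit := Coalgebra.lTensor_counit_comul (R := R) b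
  rw [← r.eq] at hcoassoc hcounit
  simp only [map_sum, LinearMap.rTensor_tmul, LinearMap.lTensor_tmul] at hcoassoc hcounit
  simp only [hF]
  rw [hcoassoc]
  simp only [F, TensorProduct.map_tmul, LinearMap.comp_apply, LinearMap.id_apply,
    HopfAlgebra.mul_antipode_lTensor_comul_apply, Algebra.algebraMap_eq_smul_one]
  simpa only [TensorProduct.tmul_smul, TensorProduct.smul_tmul', map_sum, TensorProduct.map_tmul,
    LinearMap.toSpanSingleton_apply, one_smul, LinearMap.id_apply] using
    congrArg (TensorProduct.map LinearMap.id (LinearMap.toSpanSingleton R H 1)) hcounit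

/-- Strong left invariance: `Σ h(a b₍₁₎) S(b₍₂₎) = Σ h(a₍₁₎ b) a₍₂₎`
for a left-invariant functional `h`. -/
theorem sum_smul_antipode_eq_sum_smul {R H : Type*} [CommSemiring R] [Semiring H]
    [HopfAlgebra R H] (h : H →ₗ[R] R)
    (hinv : ∀ a : H,
      TensorProduct.lid R H (TensorProduct.map h LinearMap.id (Coalgebra.comul a)) = h a • 1)
    {ι κ : Type*} {a b : H} (ra : Coalgebra.Repr R a ι) (rb : Coalgebra.Repr R b κ) :
    ∑ i ∈ rb.index, h (a * rb.left i) • antipode R (rb.right i) =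
      ∑ i ∈ ra.index, h (ra.left i * b) • ra.right i := by
  let L : H ⊗[R] H →ₗ[R] H :=
    (TensorProduct.lid R H).toLinearMap ∘ₗ TensorProduct.map h LinearMap.id
  have hL (u : H ⊗[R] H) (v : H) : L (u * ((1 : H) ⊗ₜ[R] v)) = L u * v := by
    induction u with
    | zero => simp
    | add x y hx hy => simp only [add_mul, hx, hy, map_add]
    | tmul x y => simp [L]
  have hinv' (c : H) : L (Coalgebra.comul c) = h c • 1 := hinv c
  calc ∑ i ∈ rb.index, h (a * rb.left i) • antipode R (rb.right i)
      = L (Coalgebra.comul (R := R) a * ∑ i ∈ rb.index, Coalgebra.comul (R := R) (rb.left i) *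
          ((1 : H) ⊗ₜ[R] antipode R (rb.right i))) := by
        simp only [Finset.mul_sum, map_sum, ← mul_assoc, ← Bialgebra.comul_mul, hL, hinv',
          smul_mul_assoc, one_mul]
    _ = ∑ i ∈ ra.index, h (ra.left i * b) • ra.right i := by
        rw [sum_comul_mul_one_tmul_antipode, ← ra.eq]
        simp [Finset.sum_mul, L]

/-- The inverse Fourier transform turns the product `⊛` of functionals into the product of
`A`: with `Δ(η) = Σ η₍₁₎ ⊗ η₍₂₎`, one has `Σ h(η₍₁₎b)·h(S(η₍₂₎)·x·a) = h(η)·h(x·a·b)`. -/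
theorem inverse_fourier_transform_multiplicative
    (h : A →ₗ[ℂ] ℂ) (hh : IsHaarState h)
    (tstar : A ⊗[ℂ] A →+ A ⊗[ℂ] A) (hstar : StarAxioms tstar)
    (η : A) (hη_counit : Coalgebra.counit (R := ℂ) η = 1)
    (hη_coint : ∀ c : A, c * η = Coalgebra.counit (R := ℂ) c • η)
    (hη_ne : h η ≠ 0)
    (a b x : A) :
    LinearMap.mul' ℂ ℂ (TensorProduct.map
        (h ∘ₗ LinearMap.mulRight ℂ b)
        (h ∘ₗ LinearMap.mulRight ℂ (x * a) ∘ₗ antipode (R := ℂ))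
        (Coalgebra.comul (R := ℂ) η))
      = h η * h (x * a * b) := by
  let r := Coalgebra.Repr.arbitrary ℂ η
  let s := Coalgebra.Repr.arbitrary ℂ b
  have hb : ∑ i ∈ r.index, h (b * r.left i) • antipode ℂ (r.right i) = h η • b := by
    rw [sum_smul_antipode_eq_sum_smul h hh.left_inv s r]
    simp only [hη_coint, map_smul, smul_eq_mul, mul_comm _ (h η), mul_smul, ← Finset.smul_sum]
    rw [Coalgebra.sum_counit_smul s]
  have key := congrArg (fun y => h (y * (x * a))) hb
  simp only [Finset.sum_mul, map_sum, smul_mul_assoc, map_smul, smul_eq_mul] at key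
  rw [hh.trace (x * a) b, ← key, ← r.eq]
  simp [hh.trace b, mul_assoc]
end
end

section
/- Let A be a finite quantum group with Haar state h and Haar element η, with S² = id. Let φ₁, φ₂ be idempotent states on A with associated group-like projections p₁, p₂ (so φᵢ(a) = h(pᵢ a pᵢ)/h(pᵢ) for all a). Then for every x ∈ A: h(p₁)·h(p₂)·Σ φ₁(S(η₍₂₎)·x)·φ₂(η₍₁₎) = h(η)·h(x·p₁·p₂), where Δ(η) = Σ η₍₁₎ ⊗ η₍₂₎ in Sweedler notation. Equivalently, (φ₁ ⊛ φ₂)(x) = h(x p₁ p₂)/(h(p₁)h(p₂)), where (φ₁ ⊛ φ₂)(x) := (1/h(η))·Σ φ₁(S(η₍₂₎)x)·φ₂(η₍₁₎). -/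
open TensorProduct HopfAlgebra
open scoped ComplexOrder

noncomputable section

variable {A : Type*} [Ring A] [StarRing A] [HopfAlgebra ℂ A]
  [StarModule ℂ A] [FiniteDimensional ℂ A]

/-- Fourier inversion for the Haar element: `Σ h(b η₍₁₎) S(η₍₂₎) = h(η) b`. -/
theorem sum_haar_mul_smul_antipode {R B : Type*} [CommSemiring R] [Semiring B] [HopfAlgebra R B]
    (h : B →ₗ[R] R)
    (hinv : ∀ a : B, TensorProduct.lid R B
      (TensorProduct.map h LinearMap.id (Coalgebra.comul a)) = h a • 1)
    (η : B) (hη : ∀ c : B, c * η = Coalgebra.counit (R := R) c • η)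
    {ι : Type*} (r : Coalgebra.Repr R η ι) (b : B) :
    ∑ k ∈ r.index, h (b * r.left k) • antipode R (r.right k) = h η • b := by
  have hS (a : B) : TensorProduct.lid R B
      (TensorProduct.map h (antipode R) (Coalgebra.comul a)) = h a • 1 := by
    have hlin : (TensorProduct.lid R B).toLinearMap ∘ₗ TensorProduct.map h (antipode R) =
        antipode R ∘ₗ (TensorProduct.lid R B).toLinearMap ∘ₗ
          TensorProduct.map h LinearMap.id := by
      ext; simp
    have := LinearMap.congr_fun hlin (Coalgebra.comul a)
    simpa [hinv] using this
  let W : B →ₗ[R] B := ∑ k ∈ r.index,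
    (h ∘ₗ LinearMap.mulRight R (r.left k)).smulRight (antipode R (r.right k))
  have hWS : WithConv.toConv W * WithConv.toConv (antipode R) =
      h η • (1 : WithConv (B →ₗ[R] B)) := by
    ext c
    have hcη : h (c * η) = Coalgebra.counit (R := R) c * h η := by
      rw [hη, map_smul, smul_eq_mul]
    have hc := hS (c * η)
    rw [hcη, Bialgebra.comul_mul, ← r.eq, ← (Coalgebra.Repr.arbitrary R c).eq] at hc
    rw [(Coalgebra.Repr.arbitrary R c).convMul_apply]
    simpa [W, Finset.sum_mul, Finset.mul_sum, Finset.sum_comm (s := r.index),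
      antipode_mul_antidistrib, Algebra.algebraMap_eq_smul_one, smul_smul, mul_comm] using hc
  have hW : WithConv.toConv W = h η • WithConv.toConv (LinearMap.id : B →ₗ[R] B) := by
    rw [← mul_one (WithConv.toConv W), ← LinearMap.antipode_mul_id, ← mul_assoc, hWS,
      smul_mul_assoc, one_mul]
  simpa [W] using LinearMap.congr_fun (congrArg WithConv.ofConv hW) b

/-- A faithful state does not vanish on a nonzero projection. -/
theorem IsHaarState.map_projection_ne_zero {B : Type*} [Ring B] [StarRing B] [HopfAlgebra ℂ B]
    {h : B →ₗ[ℂ] ℂ} (hh : IsHaarState h) {p : B}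
    (hp : p ≠ 0) (hstar : star p = p) (hmul : p * p = p) : h p ≠ 0 := fun h0 =>
  hp (hh.faithful p (by rw [hstar, hmul, h0]))

/-- A trace satisfies `h(p a p) = h(p a)` for an idempotent `p`. -/
theorem IsHaarState.map_conj_projection {B : Type*} [Ring B] [StarRing B] [HopfAlgebra ℂ B]
    {h : B →ₗ[ℂ] ℂ} (hh : IsHaarState h) {p : B} (hmul : p * p = p) (a : B) :
    h (p * a * p) = h (p * a) := by
  rw [hh.trace, ← mul_assoc, hmul]

/-- For idempotent states `φ₁, φ₂` with associated group-like projections `p₁, p₂`: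
`h(p₁)·h(p₂)·Σ φ₁(S(η₍₂₎)·x)·φ₂(η₍₁₎) = h(η)·h(x·p₁·p₂)`, i.e.
`(φ₁ ⊛ φ₂)(x) = h(x p₁ p₂)/(h(p₁)h(p₂))`. -/
theorem conv_hash_eq_product_of_projections
    (h : A →ₗ[ℂ] ℂ) (hh : IsHaarState h)
    (tstar : A ⊗[ℂ] A →+ A ⊗[ℂ] A) (hstar : StarAxioms tstar)
    (η : A) (hη_counit : Coalgebra.counit (R := ℂ) η = 1)
    (hη_coint : ∀ c : A, c * η = Coalgebra.counit (R := ℂ) c • η)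
    (hη_ne : h η ≠ 0)
    (φ₁ φ₂ : A →ₗ[ℂ] ℂ)
    (hφ₁ : IsIdempotentState φ₁) (hφ₂ : IsIdempotentState φ₂)
    (p₁ p₂ : A) (hp₁ : IsGroupLikeProjection p₁) (hp₂ : IsGroupLikeProjection p₂)
    (hφp₁ : ∀ a : A, φ₁ a = h (p₁ * a * p₁) / h p₁)
    (hφp₂ : ∀ a : A, φ₂ a = h (p₂ * a * p₂) / h p₂)
    (x : A) :
    h p₁ * h p₂ *
      LinearMap.mul' ℂ ℂ (TensorProduct.map φ₂
        (φ₁ ∘ₗ LinearMap.mulRight ℂ x ∘ₗ antipode (R := ℂ))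
        (Coalgebra.comul (R := ℂ) η))
      = h η * h (x * p₁ * p₂) := by
  have h₁ (a : A) : h p₁ * φ₁ a = h (p₁ * a) := by
    rw [hφp₁, hh.map_conj_projection hp₁.2.2.1,
      mul_div_cancel₀ _ (hh.map_projection_ne_zero hp₁.1 hp₁.2.1 hp₁.2.2.1)]
  have h₂ (a : A) : h p₂ * φ₂ a = h (p₂ * a) := by
    rw [hφp₂, hh.map_conj_projection hp₂.2.2.1,
      mul_div_cancel₀ _ (hh.map_projection_ne_zero hp₂.1 hp₂.2.1 hp₂.2.2.1)]
  let r := Coalgebra.Repr.arbitrary ℂ η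
  have key := congrArg (fun y => h (x * p₁ * y))
    (sum_haar_mul_smul_antipode h hh.left_inv η hη_coint r p₂)
  simp only [Finset.mul_sum, map_sum, mul_smul_comm, map_smul, smul_eq_mul] at key
  rw [← key, ← r.eq, map_sum, map_sum, Finset.mul_sum]
  refine Finset.sum_congr rfl fun k _ => ?_
  have hcyc (s : A) : h (x * p₁ * s) = h (p₁ * (s * x)) := by
    rw [mul_assoc, hh.trace, mul_assoc]
  simp only [TensorProduct.map_tmul, LinearMap.mul'_apply, LinearMap.comp_apply,
    LinearMap.mulRight_apply, hcyc, ← h₁, ← h₂]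
  ring
end
end

section
/- Let φ₁ and φ₂ be idempotent states on a finite quantum group A. Then φ₁ ⋆ φ₂ = φ₂ if and only if φ₂ ⋆ φ₁ = φ₂. -/
open TensorProduct HopfAlgebra
open scoped ComplexOrder

noncomputable section

variable {A : Type*} [Ring A] [StarRing A] [HopfAlgebra ℂ A]
  [StarModule ℂ A] [FiniteDimensional ℂ A]

omit [FiniteDimensional ℂ A] in
/-- A positive linear functional is hermitian. -/
theorem map_star_of_nonneg {φ : A →ₗ[ℂ] ℂ} (hφ : ∀ a : A, 0 ≤ φ (star a * a)) (a : A) :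
    φ (star a) = star (φ a) := by
  have him (x : A) : (φ (star x * x)).im = 0 := (Complex.nonneg_iff.mp (hφ x)).2.symm
  have h₀ := him a
  have h₁ := him 1
  have h₂ := him (a + 1)
  have h₃ := him (a + Complex.I • (1 : A))
  simp only [star_add, star_one, star_smul, add_mul, mul_add, mul_one, one_mul, map_add, map_smul,
    smul_mul_assoc, mul_smul_comm, smul_eq_mul, Complex.add_im, Complex.star_def, Complex.conj_I,
    Complex.mul_im, Complex.mul_re, Complex.neg_re, Complex.neg_im, Complex.I_re, Complex.I_im]
    at h₀ h₁ h₂ h₃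
  apply Complex.ext
  · rw [Complex.star_def, Complex.conj_re]; linarith
  · rw [Complex.star_def, Complex.conj_im]; linarith

omit [FiniteDimensional ℂ A] in
/-- The Gram matrix of a positive functional is positive semidefinite. -/
theorem posSemidef_gram_of_nonneg {φ : A →ₗ[ℂ] ℂ} (hφ : ∀ a : A, 0 ≤ φ (star a * a))
    {ι : Type*} [Fintype ι] (v : ι → A) :
    (Matrix.of fun i j => φ (star (v i) * v j)).PosSemidef := by
  refine .of_dotProduct_mulVec_nonneg ?_ fun x => ?_
  · ext i j
    simp [Matrix.conjTranspose_apply, ← map_star_of_nonneg hφ]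
  · convert hφ (∑ i, x i • v i) using 1
    simp [dotProduct, Matrix.mulVec, Finset.mul_sum, Finset.sum_mul, star_sum, mul_comm]
    rw [Finset.sum_comm]
    simp only [mul_assoc]

omit [FiniteDimensional ℂ A] in
/-- The tensor product of two positive functionals is positive. -/
theorem map_tstar_mul_self_nonneg {φ ψ : A →ₗ[ℂ] ℂ} (hφ : ∀ a : A, 0 ≤ φ (star a * a))
    (hψ : ∀ a : A, 0 ≤ ψ (star a * a)) {tstar : A ⊗[ℂ] A →+ A ⊗[ℂ] A}
    (hstar : ∀ a b : A, tstar (a ⊗ₜ[ℂ] b) = star a ⊗ₜ[ℂ] star b) (X : A ⊗[ℂ] A) :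
    0 ≤ LinearMap.mul' ℂ ℂ (TensorProduct.map φ ψ (tstar X * X)) := by
  obtain ⟨k, a, b, rfl⟩ := TensorProduct.exists_sum_tmul_eq X
  have key := ((posSemidef_gram_of_nonneg hφ a).hadamard
    (posSemidef_gram_of_nonneg hψ b)).dotProduct_mulVec_nonneg 1
  convert key using 1
  simp [dotProduct, Matrix.mulVec, Finset.mul_sum, Finset.sum_mul, hstar]
  rw [Finset.sum_comm]

/-- The right convolution operator `a ↦ (id ⊗ φ)(Δ a)`. -/
def convRight (φ : A →ₗ[ℂ] ℂ) : A →ₗ[ℂ] A :=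
  (TensorProduct.rid ℂ A).toLinearMap ∘ₗ TensorProduct.map LinearMap.id φ ∘ₗ Coalgebra.comul

omit [StarRing A] [StarModule ℂ A] [FiniteDimensional ℂ A] in
theorem convRight_apply (φ : A →ₗ[ℂ] ℂ) (a : A) :
    convRight φ a =
      TensorProduct.rid ℂ A (TensorProduct.map LinearMap.id φ (Coalgebra.comul a)) := rfl

omit [StarRing A] [StarModule ℂ A] [FiniteDimensional ℂ A] in
theorem convRight_convRight (φ ψ : A →ₗ[ℂ] ℂ) (a : A) :
    convRight φ (convRight ψ a) = convRight (conv φ ψ) a := by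
  have slice (y : A) (Y : A ⊗[ℂ] A) :
      TensorProduct.rid ℂ A (TensorProduct.map LinearMap.id
        (LinearMap.mul' ℂ ℂ ∘ₗ TensorProduct.map φ ψ) (TensorProduct.assoc ℂ A A A (Y ⊗ₜ[ℂ] y))) =
      ψ y • TensorProduct.rid ℂ A (TensorProduct.map LinearMap.id φ Y) := by
    induction Y with
    | zero => simp
    | tmul u v => simp [smul_smul, mul_comm]
    | add Y Z hY hZ => simp only [TensorProduct.add_tmul, map_add, hY, hZ, smul_add]
  have slices (X : A ⊗[ℂ] A) :
      convRight φ (TensorProduct.rid ℂ A (TensorProduct.map LinearMap.id ψ X)) =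
      TensorProduct.rid ℂ A (TensorProduct.map LinearMap.id
        (LinearMap.mul' ℂ ℂ ∘ₗ TensorProduct.map φ ψ)
          (TensorProduct.assoc ℂ A A A (Coalgebra.comul.rTensor A X))) := by
    induction X with
    | zero => simp
    | tmul x y =>
      rw [LinearMap.rTensor_tmul, slice]
      simp [convRight_apply]
    | add X Y hX hY => simp only [map_add, hX, hY]
  rw [convRight_apply ψ, slices, Coalgebra.coassoc_apply, LinearMap.lTensor, convRight_apply,
    ← LinearMap.comp_apply (TensorProduct.map _ _), ← TensorProduct.map_comp]
  rfl

omit [StarRing A] [StarModule ℂ A] [FiniteDimensional ℂ A] in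
theorem convRight_injective : Function.Injective (convRight : (A →ₗ[ℂ] ℂ) → A →ₗ[ℂ] A) := by
  have counit_slice (φ : A →ₗ[ℂ] ℂ) (X : A ⊗[ℂ] A) :
      Coalgebra.counit (R := ℂ) (TensorProduct.rid ℂ A (TensorProduct.map LinearMap.id φ X)) =
      φ (TensorProduct.lid ℂ A (Coalgebra.counit.rTensor A X)) := by
    induction X with
    | zero => simp
    | tmul x y => simp [mul_comm]
    | add X Y hX hY => simp only [map_add, hX, hY]
  have counit_convRight (φ : A →ₗ[ℂ] ℂ) (a : A) :
      Coalgebra.counit (R := ℂ) (convRight φ a) = φ a := by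
    rw [convRight_apply, counit_slice, Coalgebra.rTensor_counit_comul]
    simp
  intro φ ψ hφψ
  ext a
  rw [← counit_convRight φ, hφψ, counit_convRight]

omit [FiniteDimensional ℂ A] in
theorem convRight_star {φ : A →ₗ[ℂ] ℂ} (hφ : IsState φ) {tstar : A ⊗[ℂ] A →+ A ⊗[ℂ] A}
    (hstar : StarAxioms tstar) (a : A) : convRight φ (star a) = star (convRight φ a) := by
  have slice (X : A ⊗[ℂ] A) :
      TensorProduct.rid ℂ A (TensorProduct.map LinearMap.id φ (tstar X)) =
      star (TensorProduct.rid ℂ A (TensorProduct.map LinearMap.id φ X)) := by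
    induction X with
    | zero => simp
    | tmul x y => simp [hstar.tstar_tmul, map_star_of_nonneg hφ.2]
    | add X Y hX hY => simp only [map_add, hX, hY, star_add]
  rw [convRight_apply, hstar.comul_star, slice, convRight_apply]

omit [FiniteDimensional ℂ A] in
/-- Right convolution by a state is a contraction for the inner product of the Haar state. -/
theorem haar_convRight_le {h : A →ₗ[ℂ] ℂ} (hh : IsHaarState h)
    {tstar : A ⊗[ℂ] A →+ A ⊗[ℂ] A} (hstar : StarAxioms tstar)
    {φ : A →ₗ[ℂ] ℂ} (hφ : IsState φ) (a : A) :
    h (star (convRight φ a) * convRight φ a) ≤ h (star a * a) := by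
  set T : A ⊗[ℂ] A →ₗ[ℂ] ℂ := LinearMap.mul' ℂ ℂ ∘ₗ TensorProduct.map h φ with hT
  have T_left (c : A) (X : A ⊗[ℂ] A) : T ((c ⊗ₜ[ℂ] 1) * X) =
      h (c * TensorProduct.rid ℂ A (TensorProduct.map LinearMap.id φ X)) := by
    induction X with
    | zero => simp
    | tmul x y => simp [hT, mul_comm]
    | add X Y hX hY => simp only [map_add, mul_add, hX, hY]
  have T_right (c : A) (X : A ⊗[ℂ] A) : T (X * (c ⊗ₜ[ℂ] 1)) =
      h (TensorProduct.rid ℂ A (TensorProduct.map LinearMap.id φ X) * c) := by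
    induction X with
    | zero => simp
    | tmul x y => simp [hT, mul_comm]
    | add X Y hX hY => simp only [map_add, add_mul, hX, hY]
  have T_eq (X : A ⊗[ℂ] A) :
      T X = φ (TensorProduct.lid ℂ A (TensorProduct.map h LinearMap.id X)) := by
    induction X with
    | zero => simp
    | tmul x y => simp [hT]
    | add X Y hX hY => simp only [map_add, hX, hY]
  have T_comul (x : A) : T (Coalgebra.comul x) = h x := by
    rw [T_eq, hh.left_inv, map_smul, hφ.1, smul_eq_mul, mul_one]
  have T_one (c d : A) : T ((c ⊗ₜ[ℂ] 1) * (d ⊗ₜ[ℂ] 1)) = h (c * d) := by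
    simp [hT, hφ.1]
  have key : 0 ≤ T (tstar (Coalgebra.comul a - convRight φ a ⊗ₜ[ℂ] 1) *
      (Coalgebra.comul a - convRight φ a ⊗ₜ[ℂ] 1)) :=
    map_tstar_mul_self_nonneg hh.state.2 hφ.2 hstar.tstar_tmul _
  rw [map_sub tstar, ← hstar.comul_star, hstar.tstar_tmul, star_one, sub_mul, mul_sub, mul_sub,
    ← Bialgebra.comul_mul, map_sub, map_sub, map_sub, T_comul, T_one, T_left, T_right,
    ← convRight_apply, ← convRight_apply, convRight_star hφ hstar, sub_self, sub_zero] at key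
  exact sub_nonneg.mp key

omit [FiniteDimensional ℂ A] in
/-- An idempotent contraction has range orthogonal to its kernel. -/
theorem star_mul_eq_zero_of_contraction {h : A →ₗ[ℂ] ℂ} (hh : ∀ a : A, 0 ≤ h (star a * a))
    {E : A →ₗ[ℂ] A} (hE : ∀ a, h (star (E a) * E a) ≤ h (star a * a)) {r k : A}
    (hr : E r = r) (hk : E k = 0) : h (star r * k) = 0 := by
  set z := h (star r * k) with hz
  have hz' : h (star k * r) = star z := by
    rw [hz, ← map_star_of_nonneg hh, star_mul, star_star]
  set m := h (star k * k) with hm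
  have hm0 : 0 ≤ m.re ∧ 0 = m.im := Complex.nonneg_iff.mp (hh k)
  have ineq (t : ℝ) : 0 ≤ -2 * t * Complex.normSq z + t ^ 2 * Complex.normSq z * m.re := by
    have := hE (r + (-(t : ℂ) * star z) • k)
    rw [map_add, map_smul, hk, hr, smul_zero, add_zero, star_add, star_smul, add_mul, mul_add,
      mul_add, map_add, map_add, map_add] at this
    simp only [smul_mul_assoc, mul_smul_comm, map_smul, ← hz, hz', ← hm, smul_eq_mul] at this
    have := (Complex.le_def.mp this).1
    simp [← hm0.2, Complex.normSq_apply] at this ⊢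
    nlinarith
  have hN := Complex.normSq_nonneg z
  have := ineq (1 / (m.re + 1))
  have hpos : 0 < m.re + 1 := by linarith [hm0.1]
  have e : -2 * (1 / (m.re + 1)) * Complex.normSq z +
      (1 / (m.re + 1)) ^ 2 * Complex.normSq z * m.re =
      -(Complex.normSq z * ((m.re + 2) / (m.re + 1) ^ 2)) := by
    field_simp; ring
  rw [e] at this
  have hq : 0 < (m.re + 2) / (m.re + 1) ^ 2 := by
    have : 0 < m.re + 2 := by linarith
    positivity
  exact Complex.normSq_eq_zero.mp (le_antisymm (by nlinarith) hN)

omit [FiniteDimensional ℂ A] in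
/-- Right convolution by an idempotent state is symmetric for the inner product of the Haar
state. -/
theorem haar_convRight_symm {h : A →ₗ[ℂ] ℂ} (hh : IsHaarState h)
    {tstar : A ⊗[ℂ] A →+ A ⊗[ℂ] A} (hstar : StarAxioms tstar)
    {φ : A →ₗ[ℂ] ℂ} (hφ : IsIdempotentState φ) (a b : A) :
    h (star (convRight φ a) * b) = h (star a * convRight φ b) := by
  have idem (x : A) : convRight φ (convRight φ x) = convRight φ x := by
    rw [convRight_convRight, hφ.2]
  have orth (x y : A) : h (star (convRight φ x) * (y - convRight φ y)) = 0 :=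
    star_mul_eq_zero_of_contraction hh.state.2 (haar_convRight_le hh hstar hφ.1) (idem x)
      (by rw [map_sub, idem, sub_self])
  have orth' : h (star (a - convRight φ a) * convRight φ b) = 0 := by
    have := congrArg star (orth b a)
    rwa [← map_star_of_nonneg hh.state.2, star_mul, star_star, star_zero] at this
  have orth'' := orth a b
  rw [mul_sub, map_sub, sub_eq_zero] at orth''
  rw [star_sub, sub_mul, map_sub, sub_eq_zero] at orth'
  rw [orth'', orth']

omit [FiniteDimensional ℂ A] in
/-- Absorption of idempotent states is symmetric: `φ ⋆ ψ = ω` forces `ψ ⋆ φ = ω`. -/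
theorem conv_eq_of_conv_eq {h : A →ₗ[ℂ] ℂ} (hh : IsHaarState h)
    {tstar : A ⊗[ℂ] A →+ A ⊗[ℂ] A} (hstar : StarAxioms tstar) {φ ψ ω : A →ₗ[ℂ] ℂ}
    (hφ : IsIdempotentState φ) (hψ : IsIdempotentState ψ) (hω : IsIdempotentState ω)
    (hconv : conv φ ψ = ω) : conv ψ φ = ω := by
  apply convRight_injective
  ext a
  have weak (b : A) : h (star (convRight (conv ψ φ) a - convRight ω a) * b) = 0 := by
    rw [star_sub, sub_mul, map_sub, ← convRight_convRight, haar_convRight_symm hh hstar hψ,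
      haar_convRight_symm hh hstar hφ, convRight_convRight, hconv,
      haar_convRight_symm hh hstar hω, sub_self]
  exact sub_eq_zero.mp (hh.faithful _ (weak _))

/-- For idempotent states `φ₁, φ₂` on a finite quantum group,
`φ₁ ⋆ φ₂ = φ₂` if and only if `φ₂ ⋆ φ₁ = φ₂`. -/
theorem conv_eq_comm
    (h : A →ₗ[ℂ] ℂ) (hh : IsHaarState h)
    (tstar : A ⊗[ℂ] A →+ A ⊗[ℂ] A) (hstar : StarAxioms tstar)
    (φ₁ φ₂ : A →ₗ[ℂ] ℂ)
    (hφ₁ : IsIdempotentState φ₁) (hφ₂ : IsIdempotentState φ₂) :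
    conv φ₁ φ₂ = φ₂ ↔ conv φ₂ φ₁ = φ₂ := by
  exact ⟨conv_eq_of_conv_eq hh hstar hφ₁ hφ₂ hφ₂, conv_eq_of_conv_eq hh hstar hφ₂ hφ₁ hφ₂⟩
end
end

section
/- Let φ be an idempotent state on a finite quantum group A with associated group-like projection p (so φ(a) = h(p a p)/h(p) for all a). Then the null space of φ equals the left annihilator of p: N_φ = {a ∈ A : a·p = 0}. -/
open TensorProduct HopfAlgebra
open scoped ComplexOrder

noncomputable section

variable {A : Type*} [Ring A] [StarRing A] [HopfAlgebra ℂ A]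
  [StarModule ℂ A] [FiniteDimensional ℂ A]

/-- The null space of an idempotent state equals the left annihilator of its associated
group-like projection: `N_φ = {a : a·p = 0}`. -/
theorem null_space_eq_left_annihilator
    (h : A →ₗ[ℂ] ℂ) (hh : IsHaarState h)
    (tstar : A ⊗[ℂ] A →+ A ⊗[ℂ] A) (hstar : StarAxioms tstar)
    (φ : A →ₗ[ℂ] ℂ) (hφ : IsIdempotentState φ)
    (p : A) (hp : IsGroupLikeProjection p)
    (hφp : ∀ a : A, φ a = h (p * a * p) / h p) :
    {a : A | φ (star a * a) = 0} = {a : A | a * p = 0} := by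
  obtain ⟨hp0, hps, hpp, -⟩ := hp
  have hhp : h p ≠ 0 := fun h0 => hp0 (hh.faithful p (by rw [hps, hpp, h0]))
  have key (a : A) : p * (star a * a) * p = star (a * p) * (a * p) := by
    rw [star_mul, hps]
    simp only [mul_assoc]
  ext a
  simp only [Set.mem_ofPred_eq, hφp, key, div_eq_zero_iff, hhp, or_false]
  exact ⟨hh.faithful _, fun ha => by rw [ha, mul_zero, map_zero]⟩
end
end

section
/- Let φ be an idempotent state on a finite quantum group A with associated group-like projection p (so φ(a) = h(p a p)/h(p) for all a). Then the following conditions are equivalent: (a) N_φ is closed under the star operation; (b) N_φ is a two-sided ideal of A; (c) S(N_φ) = N_φ; (d) p lies in the center of A. -/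
open TensorProduct HopfAlgebra
open scoped ComplexOrder

noncomputable section

variable {A : Type*} [Ring A] [StarRing A] [HopfAlgebra ℂ A]
  [StarModule ℂ A] [FiniteDimensional ℂ A]

section GroupLikeProjection

variable {k H : Type*} [Field k] [Ring H] [HopfAlgebra k H]

/-- An idempotent `p ≠ 0` over a field with `Δ(p)(1 ⊗ p) = p ⊗ p` has counit `1`. -/
theorem counit_eq_one_of_comul_mul {p : H}
    (hp0 : p ≠ 0) (hpp : p * p = p)
    (hΔ : Coalgebra.comul (R := k) p * ((1 : H) ⊗ₜ[k] p) = p ⊗ₜ[k] p) :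
    Coalgebra.counit (R := k) p = 1 := by
  have key : ∀ t : H ⊗[k] H, TensorProduct.lid k H
      ((Coalgebra.counit (R := k)).rTensor H (t * ((1 : H) ⊗ₜ[k] p))) =
      TensorProduct.lid k H ((Coalgebra.counit (R := k)).rTensor H t) * p := by
    intro t
    induction t with
    | zero => simp
    | tmul x y => simp
    | add x y hx hy => simp only [add_mul, map_add, hx, hy]
  have h1 := key (Coalgebra.comul p)
  rw [hΔ, Coalgebra.rTensor_counit_comul] at h1
  simp only [LinearMap.rTensor_tmul, TensorProduct.lid_tmul, one_smul, hpp] at h1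
  have h2 : (Coalgebra.counit (R := k) p - 1) • p = 0 := by
    rw [sub_smul, one_smul, h1, sub_self]
  exact sub_eq_zero.mp ((smul_eq_zero.mp h2).resolve_right hp0)

/-- If `Δ(p)(1 ⊗ p) = p ⊗ p`, then `S(p) p = ε(p) p`. -/
theorem antipode_mul_self_of_comul_mul {p : H}
    (hΔ : Coalgebra.comul (R := k) p * ((1 : H) ⊗ₜ[k] p) = p ⊗ₜ[k] p) :
    antipode k p * p = Coalgebra.counit (R := k) p • p := by
  have key : ∀ t : H ⊗[k] H, LinearMap.mul' k H
      ((antipode k).rTensor H (t * ((1 : H) ⊗ₜ[k] p))) =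
      LinearMap.mul' k H ((antipode k).rTensor H t) * p := by
    intro t
    induction t with
    | zero => simp
    | tmul x y => simp [mul_assoc]
    | add x y hx hy => simp only [add_mul, map_add, hx, hy]
  have h1 := key (Coalgebra.comul p)
  rw [hΔ, mul_antipode_rTensor_comul_apply] at h1
  simpa [Algebra.smul_def] using h1

/-- An idempotent `p ≠ 0` with `Δ(p)(1 ⊗ p) = p ⊗ p` is fixed by an involutive antipode. -/
theorem antipode_eq_self_of_comul_mul {p : H} (hp0 : p ≠ 0) (hpp : p * p = p)
    (hΔ : Coalgebra.comul (R := k) p * ((1 : H) ⊗ₜ[k] p) = p ⊗ₜ[k] p)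
    (hinv : ∀ a : H, antipode k (antipode k a) = a) : antipode k p = p := by
  have h1 : antipode k p * p = p := by
    rw [antipode_mul_self_of_comul_mul hΔ, counit_eq_one_of_comul_mul hp0 hpp hΔ, one_smul]
  have h2 := congrArg (antipode k) h1
  rw [antipode_mul_antidistrib, hinv, h1] at h2
  exact h2.symm

end GroupLikeProjection

/-- A projection `p` is central as soon as `(1 - p) x p = 0` for all `x`. -/
theorem central_of_one_sub_mul_mul_eq_zero {B : Type*} [Ring B] [StarRing B] {p : B}
    (hps : star p = p) (h : ∀ x : B, (1 - p) * x * p = 0) (x : B) : p * x = x * p := by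
  have h1 : ∀ y : B, y * p = p * y * p := fun y => by
    have := h y
    rwa [sub_mul, sub_mul, one_mul, sub_eq_zero] at this
  have h2 := congrArg star (h1 (star x))
  simp only [star_mul, star_star, hps] at h2
  rw [h2, ← mul_assoc, ← h1]

/-- For an idempotent state `φ` with associated group-like projection `p`, the following are
equivalent: the null space `N_φ` is star-closed; `N_φ` is a two-sided ideal; `S(N_φ) = N_φ`;
and `p` is central. -/
theorem haar_idempotent_tfae
    (h : A →ₗ[ℂ] ℂ) (hh : IsHaarState h)
    (tstar : A ⊗[ℂ] A →+ A ⊗[ℂ] A) (hstar : StarAxioms tstar)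
    (φ : A →ₗ[ℂ] ℂ) (hφ : IsIdempotentState φ)
    (p : A) (hp : IsGroupLikeProjection p)
    (hφp : ∀ a : A, φ a = h (p * a * p) / h p)
    (N : Set A) (hN : N = {a : A | φ (star a * a) = 0}) :
    List.TFAE
      [ ∀ a ∈ N, star a ∈ N,
        ∃ I : TwoSidedIdeal A, N = (I : Set A),
        antipode (R := ℂ) '' N = N,
        ∀ x : A, p * x = x * p ] := by
  obtain ⟨hp0, hps, hpp, hΔ⟩ := hp
  have hhp : h p ≠ 0 := fun h0 => hp0 (hh.faithful p (by rw [hps, hpp, h0]))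
  have hmem : ∀ a : A, a ∈ N ↔ a * p = 0 := fun a => by
    have hsq : p * (star a * a) * p = star (a * p) * (a * p) := by
      simp only [star_mul, hps, mul_assoc]
    rw [hN, Set.mem_ofPred_eq, hφp, div_eq_zero_iff, or_iff_left hhp, hsq]
    exact ⟨hh.faithful _, fun h0 => by rw [h0, mul_zero, map_zero]⟩
  have hSp : antipode ℂ p = p :=
    antipode_eq_self_of_comul_mul hp0 hpp hΔ hstar.antipode_invol
  have hqp : (1 - p) * p = 0 := by rw [sub_mul, one_mul, hpp, sub_self]
  have hpq : p * (1 - p) = 0 := by rw [mul_sub, mul_one, hpp, sub_self]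
  have hSmem : ∀ a : A, antipode ℂ a ∈ N ↔ p * a = 0 := fun a => by
    have hS : antipode ℂ (p * a) = antipode ℂ a * p := by rw [antipode_mul_antidistrib, hSp]
    rw [hmem, ← hS]
    refine ⟨fun h0 => ?_, fun h0 => by rw [h0, map_zero]⟩
    rw [← hstar.antipode_invol (p * a), h0, map_zero]
  tfae_have 1 → 4 := fun ha => by
    refine central_of_one_sub_mul_mul_eq_zero hps fun x => ?_
    have hx := ha (star x * (1 - p)) ((hmem _).2 (by rw [mul_assoc, hqp, mul_zero]))
    rw [hmem] at hx
    simpa [hps] using hx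
  tfae_have 2 → 4 := fun ⟨I, hI⟩ => by
    refine central_of_one_sub_mul_mul_eq_zero hps fun x => ?_
    rw [← hmem, hI]
    have hq : 1 - p ∈ (I : Set A) := hI ▸ (hmem _).2 hqp
    exact I.mul_mem_right _ _ hq
  tfae_have 3 → 4 := fun hS => by
    refine central_of_one_sub_mul_mul_eq_zero hps fun x => ?_
    have hx : antipode ℂ ((1 - p) * x) ∈ N :=
      (hSmem _).2 (by rw [← mul_assoc, hpq, zero_mul])
    rw [← hmem, ← hS]
    exact ⟨_, hx, hstar.antipode_invol _⟩
  tfae_have 4 → 1 := fun hc a ha => by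
    rw [hmem] at ha ⊢
    rw [← hc, ← star_star (p * star a), star_mul, star_star, hps, ha, star_zero]
  tfae_have 4 → 2 := fun hc => by
    refine ⟨.mk' N ?_ ?_ ?_ ?_ ?_, (TwoSidedIdeal.coe_mk' ..).symm⟩
    · rw [hmem, zero_mul]
    · intro x y hx hy
      rw [hmem] at *
      rw [add_mul, hx, hy, add_zero]
    · intro x hx
      rw [hmem] at *
      rw [neg_mul, hx, neg_zero]
    · intro x y hy
      rw [hmem] at *
      rw [mul_assoc, hy, mul_zero]
    · intro x y hx
      rw [hmem] at *
      rw [mul_assoc, ← hc, ← mul_assoc, hx, zero_mul]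
  tfae_have 4 → 3 := fun hc => by
    have hS : ∀ a ∈ N, antipode ℂ a ∈ N := fun a ha => by
      rw [hSmem, hc, ← hmem]
      exact ha
    ext a
    constructor
    · rintro ⟨b, hb, rfl⟩
      exact hS b hb
    · exact fun ha => ⟨_, hS a ha, hstar.antipode_invol a⟩
  tfae_finish
end
end

section
/- Let φ be an idempotent state on a finite quantum group A. Then for every a ∈ A: a ∈ N_φ if and only if Δ(a) ∈ A ⊗ N_φ + N_φ ⊗ A (sum of subspaces of A ⊗ A). -/
open TensorProduct HopfAlgebra
open scoped ComplexOrder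

noncomputable section

variable {A : Type*} [Ring A] [StarRing A] [HopfAlgebra ℂ A]
  [StarModule ℂ A] [FiniteDimensional ℂ A]

section StateForm

variable {B : Type*} [Ring B] [StarRing B] [Algebra ℂ B] [StarModule ℂ B]

theorem map_star_of_forall_nonneg {φ : B →ₗ[ℂ] ℂ} (hφ : ∀ a : B, 0 ≤ φ (star a * a)) (a : B) :
    φ (star a) = star (φ a) := by
  have key : ∀ c : ℂ, (c * φ a + star c * φ (star a)).im = 0 := by
    intro c
    have h₁ := (Complex.nonneg_iff.mp (hφ (1 + c • a))).2
    have h₂ := (Complex.nonneg_iff.mp (hφ (c • a))).2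
    have h₃ := (Complex.nonneg_iff.mp (hφ 1)).2
    have e : star (1 + c • a) * (1 + c • a)
        = star 1 * 1 + star (c • a) * (c • a) + (c • a + star c • star a) := by
      simp only [star_add, star_one, star_smul, add_mul, mul_add, one_mul, mul_one]
      abel
    rw [e, map_add, map_add, Complex.add_im, Complex.add_im, ← h₂, ← h₃, map_add, map_smul,
      map_smul] at h₁
    simpa using h₁.symm
  have h₁ := key 1
  have h₂ := key Complex.I
  simp at h₁ h₂
  apply Complex.ext <;> simp <;> linarith

/-- The form `(x, y) ↦ φ (x* y)` of a positive functional is a finite sum of rank-one forms. -/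
theorem exists_star_mul_eq_sum [FiniteDimensional ℂ B] {φ : B →ₗ[ℂ] ℂ}
    (hφ : ∀ a : B, 0 ≤ φ (star a * a)) :
    ∃ (m : ℕ) (f : Fin m → B →ₗ[ℂ] ℂ),
      ∀ x y : B, φ (star x * y) = ∑ i, star (f i x) * f i y := by
  let b := Module.finBasis ℂ B
  let M : Matrix _ _ ℂ := Matrix.of fun i j => φ (star (b i) * b j)
  have hM : ∀ x y : B, φ (star x * y) = star (b.repr x : _ → ℂ) ⬝ᵥ M.mulVec (b.repr y) := by
    intro x y
    conv_lhs => rw [← b.sum_repr x, ← b.sum_repr y]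
    rw [star_sum, Finset.sum_mul_sum]
    simp only [star_smul, smul_mul_smul_comm, map_sum, map_smul, dotProduct, Matrix.mulVec,
      Finset.mul_sum, M, Matrix.of_apply, Pi.star_apply, smul_eq_mul]
    exact Finset.sum_congr rfl fun i _ => Finset.sum_congr rfl fun j _ => by ring
  have hpos : M.PosSemidef := by
    refine .of_dotProduct_mulVec_nonneg ?_ fun v => ?_
    · ext i j
      simp only [M, Matrix.conjTranspose_apply, Matrix.of_apply]
      rw [← map_star_of_forall_nonneg hφ, star_mul, star_star]
    · have := hM (b.equivFun.symm v) (b.equivFun.symm v)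
      have e : (b.repr (b.equivFun.symm v) : _ → ℂ) = v := b.equivFun.apply_symm_apply v
      rw [e] at this
      exact this ▸ hφ _
  obtain ⟨m, u, hu⟩ := Matrix.posSemidef_iff_eq_sum_vecMulVec.mp hpos
  refine ⟨m, fun i => ∑ k, star (u i k) • b.coord k, fun x y => ?_⟩
  rw [hM, hu, Matrix.sum_mulVec, dotProduct_sum]
  refine Finset.sum_congr rfl fun i _ => ?_
  rw [Matrix.vecMulVec_mulVec]
  simp only [dotProduct, Pi.star_apply, Pi.smul_apply, MulOpposite.smul_eq_mul_unop,
    MulOpposite.unop_op, LinearMap.sum_apply, LinearMap.smul_apply, Module.Basis.coord_apply,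
    smul_eq_mul, star_sum, star_mul', star_star, Finset.sum_mul]
  exact Finset.sum_congr rfl fun k _ => by ring

end StateForm

theorem ker_map_self_eq_span {K V W : Type*} [Field K] [AddCommGroup V] [Module K V]
    [AddCommGroup W] [Module K W] (f : V →ₗ[K] W) :
    LinearMap.ker (TensorProduct.map f f) =
      Submodule.span K
        ({x : V ⊗[K] V | ∃ u v : V, f v = 0 ∧ x = u ⊗ₜ[K] v} ∪
         {x : V ⊗[K] V | ∃ u v : V, f u = 0 ∧ x = u ⊗ₜ[K] v}) := by
  have hfac : TensorProduct.map f f =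
      TensorProduct.map (LinearMap.range f).subtype (LinearMap.range f).subtype ∘ₗ
        TensorProduct.map f.rangeRestrict f.rangeRestrict := by
    rw [← TensorProduct.map_comp]; rfl
  have hinj := TensorProduct.map_injective_of_flat_flat
    (LinearMap.range f).subtype (LinearMap.range f).subtype
    (Submodule.subtype_injective _) (Submodule.subtype_injective _)
  have hex : Function.Exact (LinearMap.ker f).subtype f.rangeRestrict := by
    rw [LinearMap.exact_iff, LinearMap.ker_rangeRestrict, Submodule.range_subtype]
  rw [hfac, LinearMap.ker_comp_of_ker_eq_bot _ (LinearMap.ker_eq_bot.mpr hinj),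
    TensorProduct.map_ker hex f.surjective_rangeRestrict hex f.surjective_rangeRestrict,
    LinearMap.lTensor, LinearMap.rTensor, TensorProduct.range_map_eq_span_tmul,
    TensorProduct.range_map_eq_span_tmul, ← Submodule.span_union]
  congr 2 <;> ext t <;> simp [eq_comm]

theorem map_pi_eq_zero_iff {K V : Type*} [Field K] [AddCommGroup V] [Module K V] {ι : Type*}
    [Finite ι] (f : ι → V →ₗ[K] K) (x : V ⊗[K] V) :
    TensorProduct.map (LinearMap.pi f) (LinearMap.pi f) x = 0 ↔
      ∀ i j, LinearMap.mul' K K (TensorProduct.map (f i) (f j) x) = 0 := by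
  have := Fintype.ofFinite ι
  classical
  let b := (Pi.basisFun K ι).tensorProduct (Pi.basisFun K ι)
  have hb : ∀ i j, b.repr (TensorProduct.map (LinearMap.pi f) (LinearMap.pi f) x) (i, j) =
      LinearMap.mul' K K (TensorProduct.map (f i) (f j) x) := by
    intro i j
    induction x with
    | zero => simp
    | add x y hx hy => simp only [map_add, Finsupp.add_apply, hx, hy]
    | tmul x y => simp [b, mul_comm]
  simp only [← hb]
  refine ⟨fun h i j => by simp [h], fun h => b.repr.map_eq_zero_iff.mp ?_⟩
  ext ⟨i, j⟩
  exact h i j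

/-- For an idempotent state `φ`, an element `a` lies in the null space `N_φ` if and only if
`Δ(a) ∈ A ⊗ N_φ + N_φ ⊗ A`. -/
theorem mem_null_space_iff_comul_mem
    (h : A →ₗ[ℂ] ℂ) (hh : IsHaarState h)
    (tstar : A ⊗[ℂ] A →+ A ⊗[ℂ] A) (hstar : StarAxioms tstar)
    (φ : A →ₗ[ℂ] ℂ) (hφ : IsIdempotentState φ) (a : A) :
    φ (star a * a) = 0 ↔
      Coalgebra.comul (R := ℂ) a ∈
        Submodule.span ℂ
          ({x : A ⊗[ℂ] A | ∃ u v : A, φ (star v * v) = 0 ∧ x = u ⊗ₜ[ℂ] v} ∪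
           {x : A ⊗[ℂ] A | ∃ u v : A, φ (star u * u) = 0 ∧ x = u ⊗ₜ[ℂ] v}) := by
  obtain ⟨m, f, hf⟩ := exists_star_mul_eq_sum hφ.1.2
  have hT : ∀ x y : A ⊗[ℂ] A, LinearMap.mul' ℂ ℂ (TensorProduct.map φ φ (tstar x * y)) =
      ∑ i, ∑ j, star (LinearMap.mul' ℂ ℂ (TensorProduct.map (f i) (f j) x)) *
        LinearMap.mul' ℂ ℂ (TensorProduct.map (f i) (f j) y) := by
    intro x y
    induction x with
    | zero => simp
    | add x x' hx hx' => simp only [map_add, add_mul, hx, hx', star_add, Finset.sum_add_distrib]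
    | tmul x x' =>
      induction y with
      | zero => simp
      | add y y' hy hy' => simp only [map_add, mul_add, hy, hy', Finset.sum_add_distrib]
      | tmul y y' =>
        simp only [hstar.tstar_tmul, Algebra.TensorProduct.tmul_mul_tmul, TensorProduct.map_tmul,
          LinearMap.mul'_apply, hf, Finset.sum_mul_sum, star_mul']
        exact Finset.sum_congr rfl fun i _ => Finset.sum_congr rfl fun j _ => by ring
  have hnull : ∀ v : A, LinearMap.pi f v = 0 ↔ φ (star v * v) = 0 := by
    intro v
    rw [hf, Finset.sum_eq_zero_iff_of_nonneg fun i _ => star_mul_self_nonneg _]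
    simp [funext_iff]
  have hspan := ker_map_self_eq_span (LinearMap.pi f)
  simp only [hnull] at hspan
  have hconv : φ (star a * a) =
      LinearMap.mul' ℂ ℂ (TensorProduct.map φ φ
        (tstar (Coalgebra.comul (R := ℂ) a) * Coalgebra.comul (R := ℂ) a)) := by
    rw [← hstar.comul_star, ← Bialgebra.comul_mul]
    exact (LinearMap.congr_fun hφ.2 _).symm
  rw [← hspan, LinearMap.mem_ker, map_pi_eq_zero_iff, hconv, hT,
    Finset.sum_eq_zero_iff_of_nonneg fun i _ =>
      Finset.sum_nonneg fun j _ => star_mul_self_nonneg _]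
  refine ⟨fun H i j => ?_, fun H i _ => by simp [H]⟩
  have := (Finset.sum_eq_zero_iff_of_nonneg fun j _ => star_mul_self_nonneg _).mp
    (H i (Finset.mem_univ i)) j (Finset.mem_univ j)
  simpa using this
end
end

section
/- Let φ be an idempotent state on a finite quantum group A whose null space N_φ is closed under the star operation, and let p be the associated group-like projection (so φ(a) = h(p a p)/h(p) for all a). Then: (1) for every a ∈ A, p a p = 0 if and only if a ∈ N_φ; (2) for all a, b ∈ A, p a b p = (p a p)(p b p) and p a* p = (p a p)*; consequently the map a ↦ p a p descends to a unital *-algebra isomorphism from the quotient *-algebra A/N_φ onto the corner algebra p A p (with unit p). -/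
open TensorProduct HopfAlgebra
open scoped ComplexOrder

noncomputable section

variable {A : Type*} [Ring A] [StarRing A] [HopfAlgebra ℂ A]
  [StarModule ℂ A] [FiniteDimensional ℂ A]

/-- A self-adjoint idempotent `p` such that `a p = 0` implies `star a * p = 0` is central. -/
theorem commute_of_mul_eq_zero_star {R : Type*} [Ring R] [StarRing R] {p : R}
    (hps : star p = p) (hpp : p * p = p)
    (hstar : ∀ a : R, a * p = 0 → star a * p = 0) (x : R) : p * x = x * p := by
  have key : ∀ y : R, p * y = p * y * p := by
    intro y
    have h0 : y * (1 - p) * p = 0 := by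
      rw [mul_assoc, sub_mul, one_mul, hpp, sub_self, mul_zero]
    have h1 := congrArg star (hstar _ h0)
    rw [star_mul, star_star, star_zero, hps, mul_sub, mul_one, mul_sub, ← mul_assoc] at h1
    exact sub_eq_zero.mp h1
  have h2 := congrArg star (key (star x))
  simp only [star_mul, star_star, hps] at h2
  rw [key x, h2, mul_assoc]

/-- If the null space of an idempotent state `φ` is star-closed, then the compression
`a ↦ p a p` by the associated group-like projection has kernel `N_φ` and is multiplicative
and star-preserving; hence it descends to a unital `*`-isomorphism `A/N_φ ≅ p A p`. -/
theorem corner_map_of_star_closed_null_space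
    (h : A →ₗ[ℂ] ℂ) (hh : IsHaarState h)
    (tstar : A ⊗[ℂ] A →+ A ⊗[ℂ] A) (hstar : StarAxioms tstar)
    (φ : A →ₗ[ℂ] ℂ) (hφ : IsIdempotentState φ)
    (hNstar : ∀ a : A, φ (star a * a) = 0 → φ (star (star a) * star a) = 0)
    (p : A) (hp : IsGroupLikeProjection p)
    (hφp : ∀ a : A, φ a = h (p * a * p) / h p) :
    (∀ a : A, p * a * p = 0 ↔ φ (star a * a) = 0) ∧
    (∀ a b : A, p * (a * b) * p = (p * a * p) * (p * b * p)) ∧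
    (∀ a : A, p * star a * p = star (p * a * p)) := by
  obtain ⟨hp0, hps, hpp, -⟩ := hp
  have hhp : h p ≠ 0 := fun h0 => hp0 (hh.faithful p (by rw [hps, hpp, h0]))
  have null_iff : ∀ a : A, φ (star a * a) = 0 ↔ a * p = 0 := by
    intro a
    have e : p * (star a * a) * p = star (a * p) * (a * p) := by
      rw [star_mul, hps]; simp only [mul_assoc]
    rw [hφp, e, div_eq_zero_iff, or_iff_left hhp]
    exact ⟨hh.faithful _, fun h0 => by rw [h0, mul_zero, map_zero]⟩
  have hcomm : ∀ x : A, p * x = x * p :=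
    commute_of_mul_eq_zero_star hps hpp fun a ha =>
      (null_iff (star a)).mp (hNstar a ((null_iff a).mpr ha))
  have corner : ∀ a : A, p * a * p = a * p := fun a => by rw [hcomm, mul_assoc, hpp]
  refine ⟨fun a => by rw [corner, null_iff], fun a b => ?_, fun a => ?_⟩
  · rw [corner, corner, corner, mul_assoc a p, ← mul_assoc p b p, corner, mul_assoc]
  · simp only [star_mul, hps, mul_assoc]
end
end

section
/- Let A be a finite quantum group with Haar state h and let p ∈ A be a good group-like projection. Define Δ₀(x) := (p ⊗ p)·Δ(x)·(p ⊗ p) for x ∈ p A p. Then the restriction of h to the corner p A p is left-invariant for Δ₀: for all a, b ∈ A, (h ⊗ id)(Δ₀(p a p)·(1 ⊗ p b p)) = h(p a p)·(p b p). -/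
open TensorProduct HopfAlgebra
open scoped ComplexOrder

noncomputable section

variable {A : Type*} [Ring A] [StarRing A] [HopfAlgebra ℂ A]
  [StarModule ℂ A] [FiniteDimensional ℂ A]

/-- A good group-like projection: a group-like projection with `Δ(p)(p ⊗ 1) = p ⊗ p`
and `S(p) = p`. -/
def IsGoodGroupLikeProjection (p : A) : Prop :=
  IsGroupLikeProjection p ∧
    Coalgebra.comul (R := ℂ) p * (p ⊗ₜ[ℂ] (1 : A)) = p ⊗ₜ[ℂ] p ∧
    antipode (R := ℂ) p = p

/-- The slice map `φ ⊗ id` is a bimodule map over the second tensor factor. -/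
theorem lid_map_one_tmul_mul_mul_one_tmul {R B : Type*} [CommSemiring R] [Semiring B] [Algebra R B]
    (φ : B →ₗ[R] R) (c d : B) (X : B ⊗[R] B) :
    TensorProduct.lid R B (TensorProduct.map φ LinearMap.id
      (((1 : B) ⊗ₜ[R] c) * X * ((1 : B) ⊗ₜ[R] d)))
      = c * TensorProduct.lid R B (TensorProduct.map φ LinearMap.id X) * d := by
  induction X with
  | zero => simp
  | tmul x y => simp
  | add X Y hX hY => simp only [mul_add, add_mul, map_add, hX, hY]

/-- The entrywise star turns right multiplication by a pure tensor into left multiplication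
by its star. -/
theorem StarAxioms.tstar_mul_tmul {B : Type*} [Ring B] [StarRing B] [HopfAlgebra ℂ B]
    {tstar : B ⊗[ℂ] B →+ B ⊗[ℂ] B} (hstar : StarAxioms tstar) (X : B ⊗[ℂ] B) (c d : B) :
    tstar (X * (c ⊗ₜ[ℂ] d)) = (star c ⊗ₜ[ℂ] star d) * tstar X := by
  induction X with
  | zero => simp
  | tmul x y => simp [hstar.tstar_tmul]
  | add X Y hX hY => simp only [mul_add, add_mul, map_add, hX, hY]

/-- The adjoint form `(1 ⊗ p)Δ(p) = p ⊗ p` of the group-like condition. -/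
theorem IsGroupLikeProjection.one_tmul_mul_comul {B : Type*} [Ring B] [StarRing B]
    [HopfAlgebra ℂ B] {tstar : B ⊗[ℂ] B →+ B ⊗[ℂ] B} (hstar : StarAxioms tstar) {p : B}
    (hp : IsGroupLikeProjection p) :
    ((1 : B) ⊗ₜ[ℂ] p) * Coalgebra.comul (R := ℂ) p = p ⊗ₜ[ℂ] p := by
  obtain ⟨-, hsa, -, hgl⟩ := hp
  have key := congrArg tstar hgl
  rwa [hstar.tstar_mul_tmul, ← hstar.comul_star, hstar.tstar_tmul, hsa, star_one] at key

/-- On the corner `p A p` the compression by `p ⊗ p` agrees with that by `1 ⊗ p`. -/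
theorem IsGroupLikeProjection.compress_comul {B : Type*} [Ring B] [StarRing B]
    [HopfAlgebra ℂ B] {tstar : B ⊗[ℂ] B →+ B ⊗[ℂ] B} (hstar : StarAxioms tstar) {p : B}
    (hp : IsGroupLikeProjection p) (a : B) :
    (p ⊗ₜ[ℂ] p) * Coalgebra.comul (R := ℂ) (p * a * p) * (p ⊗ₜ[ℂ] p)
      = ((1 : B) ⊗ₜ[ℂ] p) * Coalgebra.comul (R := ℂ) (p * a * p) * ((1 : B) ⊗ₜ[ℂ] p) := by
  have hl := hp.one_tmul_mul_comul hstar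
  obtain ⟨-, -, hidem, hr⟩ := hp
  have hpp : (p ⊗ₜ[ℂ] p) * Coalgebra.comul (R := ℂ) (p * a * p) * (p ⊗ₜ[ℂ] p)
      = ((1 : B) ⊗ₜ[ℂ] p) * Coalgebra.comul (R := ℂ) (p * (p * a * p) * p)
        * ((1 : B) ⊗ₜ[ℂ] p) := by
    rw [Bialgebra.comul_mul (p * (p * a * p)) p, Bialgebra.comul_mul p (p * a * p),
      mul_assoc _ _ ((1 : B) ⊗ₜ[ℂ] p), mul_assoc _ _ ((1 : B) ⊗ₜ[ℂ] p), hr, ← hl]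
    simp only [mul_assoc]
  rw [hpp]
  congr 3
  simp only [mul_assoc, hidem]
  simp only [← mul_assoc, hidem]

/-- For a good group-like projection `p`, the restriction of the Haar state to the corner
`p A p` is left-invariant for the compressed coproduct `Δ₀(x) = (p ⊗ p)Δ(x)(p ⊗ p)`:
`(h ⊗ id)(Δ₀(p a p)·(1 ⊗ p b p)) = h(p a p)·(p b p)`. -/
theorem corner_haar_left_invariant
    (h : A →ₗ[ℂ] ℂ) (hh : IsHaarState h)
    (tstar : A ⊗[ℂ] A →+ A ⊗[ℂ] A) (hstar : StarAxioms tstar)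
    (p : A) (hp : IsGoodGroupLikeProjection p) (a b : A) :
    TensorProduct.lid ℂ A (TensorProduct.map h LinearMap.id
      ((p ⊗ₜ[ℂ] p) * Coalgebra.comul (R := ℂ) (p * a * p) * (p ⊗ₜ[ℂ] p) *
        ((1 : A) ⊗ₜ[ℂ] (p * b * p))))
      = h (p * a * p) • (p * b * p) := by
  obtain ⟨hgl, -, -⟩ := hp
  rw [hgl.compress_comul hstar, mul_assoc _ ((1 : A) ⊗ₜ[ℂ] p),
    Algebra.TensorProduct.tmul_mul_tmul, one_mul, lid_map_one_tmul_mul_mul_one_tmul, hh.left_inv]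
  simp only [mul_smul_comm, smul_mul_assoc, mul_one, ← mul_assoc, hgl.2.2.1]
end
end
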